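/- arXiv:2004.01945 — 3 statements merged into one kernel-verified Lean document; each statement's English description precedes it below -/
import Mathlib

section
/- Let ε>1 and let a, b, c be real with b>0. Define for 0<x<1 the quantities ψ(x,t)=ε·log(1−xt)−log(1−t), t_s=(εx−1)/((ε−1)x), α=sgn(εx−1)·(−2ψ(x,t_s))^{1/2}, G(λ)=Γ(c+λ)/Γ(c+λ−b), f(x,t)=(1−t)^{c−b−1}(1−xt)^{−a}, A₀=f(x,t_s)·(t_s/α)^{b−1}·(∂²ψ/∂t²(x,t_s))^{−1/2}, and B₀=(A₀−(α/(εx−1))^b)/α. Then there exist δ₀∈(0,1−1/ε), C>0 and λ₀>0 such that for all x with 0<|x−1/ε|≤δ₀ and all λ≥λ₀, |₂F₁(a+ελ,b;c+λ;x) − G(λ)e^{−λψ(x,t_s)}(λ^{−b/2}·S₀(αλ^{1/2})·A₀ + λ^{−(b+1)/2}·S₁(αλ^{1/2})·B₀)| ≤ C·λ^{−1}·G(λ)e^{−λψ(x,t_s)}·(λ^{−b/2}·S₀(αλ^{1/2}) + λ^{−(b+1)/2}·S₁(αλ^{1/2})). (This is the leading-order, uniform-in-x form of the Bleistein expansion of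 Theorem 1.) -/
open MeasureTheory Real Set Filter Topology

/-- The Gauss hypergeometric function `₂F₁(p,q;r;x) = Σ_{k≥0} (p)_k (q)_k/((r)_k k!) x^k`. -/
noncomputable def hyp2F1 (p q r x : ℝ) : ℝ :=
  ∑' k : ℕ, (ascPochhammer ℝ k).eval p * (ascPochhammer ℝ k).eval q /
    ((ascPochhammer ℝ k).eval r * (Nat.factorial k : ℝ)) * x ^ k

/-- The canonical integrals `S_k(χ) = (1/Γ(b)) ∫₀^∞ τ^{b-1} (τ-χ)^k e^{-(τ-χ)²/2} dτ`;
`S₀ = W_b` and `S₁ = W_b'`. -/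
noncomputable def S (b : ℝ) (k : ℕ) (χ : ℝ) : ℝ :=
  (1 / Real.Gamma b) *
    ∫ τ in Set.Ioi (0 : ℝ), τ ^ (b - 1) * (τ - χ) ^ k * Real.exp (-(τ - χ) ^ 2 / 2)

/-- The phase `ψ(x,t) = ε log(1-xt) - log(1-t)`. -/
noncomputable def psi (ε x t : ℝ) : ℝ := ε * Real.log (1 - x * t) - Real.log (1 - t)

/-- The saddle point `t_s = (εx-1)/((ε-1)x)`. -/
noncomputable def tsad (ε x : ℝ) : ℝ := (ε * x - 1) / ((ε - 1) * x)

/-- `α = sgn(εx-1) (-2 ψ(x,t_s))^{1/2}`. -/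
noncomputable def alph (ε x : ℝ) : ℝ :=
  Real.sign (ε * x - 1) * Real.sqrt (-2 * psi ε x (tsad ε x))

/-- `G(λ) = Γ(c+λ)/Γ(c+λ-b)`. -/
noncomputable def Grat (b c lam : ℝ) : ℝ := Real.Gamma (c + lam) / Real.Gamma (c + lam - b)

/-- `f(x,t) = (1-t)^{c-b-1} (1-xt)^{-a}`. -/
noncomputable def famp (a b c x t : ℝ) : ℝ := (1 - t) ^ (c - b - 1) * (1 - x * t) ^ (-a)

/-- `∂²ψ/∂t²(x,t) = -εx²/(1-xt)² + 1/(1-t)²`. -/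
noncomputable def psi2 (ε x t : ℝ) : ℝ := -ε * x ^ 2 / (1 - x * t) ^ 2 + 1 / (1 - t) ^ 2

/-- The leading Bleistein coefficient `A₀ = f(x,t_s) (t_s/α)^{b-1} (ψ''(x,t_s))^{-1/2}`. -/
noncomputable def A0 (a b c ε x : ℝ) : ℝ :=
  famp a b c x (tsad ε x) * (tsad ε x / alph ε x) ^ (b - 1) *
    psi2 ε x (tsad ε x) ^ (-(1 : ℝ) / 2)

/-- The leading Bleistein coefficient `B₀ = (A₀ - (α/(εx-1))^b)/α`. -/
noncomputable def B0 (a b c ε x : ℝ) : ℝ :=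
  (A0 a b c ε x - (alph ε x / (ε * x - 1)) ^ b) / alph ε x

lemma binom_hasSum (p y : ℝ) (hy : |y| < 1) :
    HasSum (fun k : ℕ => (ascPochhammer ℝ k).eval p / (Nat.factorial k : ℝ) * y ^ k)
      ((1 - y) ^ (-p)) := by
  have h := (Real.one_div_one_sub_rpow_hasFPowerSeriesOnBall_zero p).hasSum (y := y) (by
    simpa [enorm_eq_nnnorm] using! hy)
  have h1 : (1 - y) ^ (-p) = 1 / (1 - (0 + y)) ^ p := by
    rw [rpow_neg (by linarith [(abs_lt.1 hy).2]), zero_add, one_div]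
  rw [h1]
  have hh : ∀ k : ℕ, (ascPochhammer ℝ k).eval p / (Nat.factorial k : ℝ) * y ^ k =
      (FormalMultilinearSeries.ofScalars ℝ (fun n => Ring.choose (p + ↑n - 1) n) k) fun _ => y := by
    intro k
    have h2 := Ring.factorial_nsmul_multichoose_eq_ascPochhammer p k
    rw [Polynomial.ascPochhammer_smeval_eq_eval, nsmul_eq_mul] at h2
    have h3 : (Nat.factorial k : ℝ) ≠ 0 := by positivity
    rw [← h2]
    simp [Ring.choose]
    rw [show p + (k:ℝ) - 1 - k + 1 = p by ring]
    field_simp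
  simp_rw [hh]
  exact h

lemma gamma_poch (b : ℝ) (hb : 0 < b) (k : ℕ) :
    Gamma (b + k) = (ascPochhammer ℝ k).eval b * Gamma b := by
  induction k with
  | zero => simp
  | succ k ih =>
    have : b + (k + 1 : ℕ) = (b + k) + 1 := by push_cast; ring
    rw [this, Real.Gamma_add_one (by positivity), ih, ascPochhammer_succ_eval]; ring

lemma beta_int (u v : ℝ) (hu : 0 < u) (hv : 0 < v) :
    IntegrableOn (fun t : ℝ => t ^ (u - 1) * (1 - t) ^ (v - 1)) (Ioo 0 1) ∧
    ∫ t in Ioo (0:ℝ) 1, t ^ (u - 1) * (1 - t) ^ (v - 1) = Gamma u * Gamma v / Gamma (u + v) := by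
  have hc := Complex.betaIntegral_convergent (u := u) (v := v) (by simpa) (by simpa)
  have hE : ∀ t ∈ Ioo (0:ℝ) 1, ((t:ℂ) ^ ((u:ℂ) - 1) * (1 - (t:ℂ)) ^ ((v:ℂ) - 1)) =
      ((t ^ (u - 1) * (1 - t) ^ (v - 1) : ℝ) : ℂ) := by
    intro t ht
    push_cast
    rw [Complex.ofReal_cpow ht.1.le, Complex.ofReal_cpow (by linarith [ht.2])]
    push_cast; rfl
  have hi : IntegrableOn (fun t : ℝ => (((t ^ (u - 1) * (1 - t) ^ (v - 1) : ℝ)) : ℂ)) (Ioo 0 1) := by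
    rw [intervalIntegrable_iff_integrableOn_Ioo_of_le zero_le_one] at hc
    exact hc.congr_fun hE measurableSet_Ioo
  refine ⟨?_, ?_⟩
  · have := hi.re
    simpa [IntegrableOn] using this
  · have h := ProbabilityTheory.beta_eq_betaIntegralReal u v hu hv
    rw [ProbabilityTheory.beta, Complex.betaIntegral, intervalIntegral.integral_of_le zero_le_one,
      integral_Ioc_eq_integral_Ioo, setIntegral_congr_fun measurableSet_Ioo hE, integral_complex_ofReal] at h
    simpa using h.symm

lemma euler_int (p b r x : ℝ) (hp : 0 < p) (hb : 0 < b) (hr : b < r) (hx : 0 < x) (hx1 : x < 1) :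
    hyp2F1 p b r x = Gamma r / Gamma (r - b) * (1 / Gamma b) *
      ∫ t in Ioo (0:ℝ) 1, t ^ (b - 1) * (1 - t) ^ (r - b - 1) * (1 - x * t) ^ (-p) := by
  have hr0 : 0 < r := hb.trans hr
  set F : ℕ → ℝ → ℝ := fun k t => ((ascPochhammer ℝ k).eval p / (Nat.factorial k : ℝ) * x ^ k) *
    (t ^ (b + k - 1) * (1 - t) ^ (r - b - 1)) with hF
  have hP : ∀ (q : ℝ) (k : ℕ), 0 < q → 0 < (ascPochhammer ℝ k).eval q :=
    fun q k hq => ascPochhammer_pos k q hq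
  have hB := fun k : ℕ => beta_int (b + k) (r - b) (by positivity) (by linarith)
  have hFi : ∀ k, IntegrableOn (F k) (Ioo 0 1) := fun k => (hB k).1.const_mul _
  have hFv : ∀ k, ∫ t in Ioo (0:ℝ) 1, F k t = (Gamma b * Gamma (r - b) / Gamma r) *
      ((ascPochhammer ℝ k).eval p * (ascPochhammer ℝ k).eval b /
    ((ascPochhammer ℝ k).eval r * (Nat.factorial k : ℝ)) * x ^ k) := by
    intro k
    simp only [hF]
    rw [integral_const_mul, (hB k).2, gamma_poch b hb k,
      show b + k + (r - b) = r + k by ring, gamma_poch r hr0 k]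
    have := (hP r k hr0).ne'
    have := (Gamma_pos_of_pos hr0).ne'
    field_simp
  have hle : ∀ k, (ascPochhammer ℝ k).eval b ≤ (ascPochhammer ℝ k).eval r := by
    intro k
    induction k with
    | zero => simp
    | succ k ih =>
      rw [ascPochhammer_succ_eval, ascPochhammer_succ_eval]
      have := (hP r k hr0).le
      gcongr
  have hsum : Summable fun k => ∫ t in Ioo (0:ℝ) 1, ‖F k t‖ := by
    have h1 : ∀ k, ∫ t in Ioo (0:ℝ) 1, ‖F k t‖ = ∫ t in Ioo (0:ℝ) 1, F k t := by
      intro k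
      refine setIntegral_congr_fun measurableSet_Ioo fun t ht => ?_
      have h0 : 0 < t := ht.1
      have h2 : 0 < 1 - t := by linarith [ht.2]
      have := hP p k hp
      exact Real.norm_of_nonneg (by simp only [hF]; positivity)
    simp_rw [h1, hFv]
    refine Summable.mul_left _ ?_
    refine Summable.of_nonneg_of_le (fun k => ?_) (fun k => ?_)
      (binom_hasSum p x (by rw [abs_of_pos hx]; exact hx1)).summable
    · have := hP p k hp
      have := hP b k hb
      have := hP r k hr0
      positivity
    · have h1 := hP p k hp
      have h2 := hP b k hb
      have h3 := hP r k hr0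
      refine mul_le_mul_of_nonneg_right ?_ (by positivity)
      rw [div_le_div_iff₀ (by positivity) (by positivity)]
      have := hle k
      have hf : (0:ℝ) < (Nat.factorial k : ℝ) := by positivity
      nlinarith [mul_le_mul_of_nonneg_left this (mul_pos h1 hf).le]
  have hmain := (hasSum_integral_of_summable_integral_norm hFi hsum).tsum_eq
  simp_rw [hFv] at hmain
  rw [tsum_mul_left] at hmain
  have hI : ∫ t in Ioo (0:ℝ) 1, ∑' k, F k t =
      ∫ t in Ioo (0:ℝ) 1, t ^ (b - 1) * (1 - t) ^ (r - b - 1) * (1 - x * t) ^ (-p) := by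
    refine setIntegral_congr_fun measurableSet_Ioo fun t ht => ?_
    have hxt : |x * t| < 1 := by
      rw [abs_of_pos (mul_pos hx ht.1)]
      nlinarith [ht.1, ht.2]
    have h := (binom_hasSum p (x * t) hxt).mul_left (t ^ (b - 1) * (1 - t) ^ (r - b - 1))
    rw [← h.tsum_eq]
    congr 1; ext k
    simp only [hF]
    rw [show b + k - 1 = (b - 1) + k by ring, rpow_add ht.1, rpow_natCast, mul_pow]
    ring
  rw [hI] at hmain
  rw [← hmain]
  unfold hyp2F1
  have := (Gamma_pos_of_pos hr0).ne'
  have := (Gamma_pos_of_pos hb).ne'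
  have : Gamma (r - b) ≠ 0 := (Gamma_pos_of_pos (by linarith)).ne'
  field_simp

noncomputable def phiF (ε v : ℝ) : ℝ := ε * Real.log ((ε - 1 + v) / ε) - Real.log v
noncomputable def mF (ε v : ℝ) : ℝ := (ε - 1) / (v * (ε - 1 + v))
noncomputable def phiC (ε : ℝ) (z : ℂ) : ℂ :=
  (ε:ℂ) * Complex.log (((ε:ℂ) - 1 + z) / ε) - Complex.log z
noncomputable def mC (ε : ℝ) (z : ℂ) : ℂ := ((ε:ℂ) - 1) / (z * ((ε:ℂ) - 1 + z))

lemma re_pos_of_ball {z : ℂ} {R : ℝ} (hR : R ≤ 1) (hz : z ∈ Metric.ball (1:ℂ) R) : 0 < z.re := by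
  have h1 : ‖z - 1‖ < R := by simpa [dist_eq_norm] using hz
  have h2 := (Complex.abs_re_le_norm (z - 1))
  rw [Complex.sub_re, Complex.one_re] at h2
  linarith [(abs_le.1 h2).1]

lemma phiC_deriv (ε : ℝ) (hε : 1 < ε) (z : ℂ) (hz : 0 < z.re) :
    HasDerivAt (phiC ε) ((z - 1) * mC ε z) z := by
  have hε0 : (ε:ℂ) ≠ 0 := by exact_mod_cast (by linarith : ε ≠ 0)
  have hz0 : z ≠ 0 := by rintro rfl; simp at hz
  have hzre : 0 < ((ε:ℂ) - 1 + z).re := by simp; linarith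
  have hz1 : (ε:ℂ) - 1 + z ≠ 0 := by
    intro h; rw [h] at hzre; simp at hzre
  have h1 : HasDerivAt (fun z : ℂ => ((ε:ℂ) - 1 + z) / ε) (1 / ε) z :=
    ((hasDerivAt_id z).const_add _).div_const _
  have hs : ((ε:ℂ) - 1 + z) / ε ∈ Complex.slitPlane := by
    left
    rw [Complex.div_ofReal_re]
    exact div_pos hzre (by linarith)
  have h2 := ((h1.clog hs).const_mul (ε:ℂ)).sub (Complex.hasDerivAt_log (z := z) (Or.inl hz))
  refine (h2.congr_deriv ?_)
  unfold mC
  field_simp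
  ring

lemma phiC_ofReal (ε : ℝ) (hε : 1 < ε) (v : ℝ) (hv : 0 < v) : phiC ε v = (phiF ε v : ℂ) := by
  unfold phiC phiF
  push_cast
  rw [Complex.ofReal_log hv.le, Complex.ofReal_log (by apply div_nonneg <;> linarith)]
  push_cast; rfl

lemma mC_ofReal (ε : ℝ) (v : ℝ) : mC ε v = (mF ε v : ℂ) := by
  unfold mC mF; push_cast; rfl

lemma exists_r (ε : ℝ) (hε : 1 < ε) : ∃ R : ℝ, 0 < R ∧ R ≤ 1 / 2 ∧ ∃ rC : ℂ → ℂ, ∃ rr : ℝ → ℝ,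
    DifferentiableOn ℂ rC (Metric.ball 1 R) ∧
    (∀ z ∈ Metric.ball (1:ℂ) R, (1 - z) ^ 2 * rC z ^ 2 = 2 * phiC ε z) ∧
    (∀ v : ℝ, |v - 1| < R → rC v = (rr v : ℂ) ∧ 0 < rr v) ∧
    rr 1 ^ 2 = (ε - 1) / ε := by
  set U := Metric.ball (1:ℂ) (1/2) with hU
  have hUo : IsOpen U := Metric.isOpen_ball
  have h1U : (1:ℂ) ∈ U := by simp [hU]
  have hUn : U ∈ 𝓝 (1:ℂ) := hUo.mem_nhds h1U
  have hre : ∀ z ∈ U, 0 < z.re := fun z hz => re_pos_of_ball (by norm_num) hz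
  have hd : DifferentiableOn ℂ (phiC ε) U := fun z hz =>
    (phiC_deriv ε hε z (hre z hz)).differentiableAt.differentiableWithinAt
  have hε0 : (ε:ℂ) ≠ 0 := by exact_mod_cast (by linarith : ε ≠ 0)
  set P1 := dslope (phiC ε) 1
  set P2 := dslope P1 1
  have hd1 : DifferentiableOn ℂ P1 U := (Complex.differentiableOn_dslope hUn).2 hd
  have hd2 : DifferentiableOn ℂ P2 U := (Complex.differentiableOn_dslope hUn).2 hd1
  have hp0 : phiC ε 1 = 0 := by simp [phiC, hε0]
  have hp1 : P1 1 = 0 := by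
    simp only [P1, dslope_same]
    rw [(phiC_deriv ε hε 1 (by simp)).deriv]; simp
  have hphi : ∀ z, phiC ε z = (z - 1) ^ 2 * P2 z := by
    intro z
    have e1 := sub_smul_dslope (phiC ε) 1 z
    have e2 := sub_smul_dslope P1 1 z
    rw [hp0, sub_zero, smul_eq_mul] at e1
    rw [hp1, sub_zero, smul_eq_mul] at e2
    rw [← e1]; change _ * P1 z = _; rw [← e2]; ring
  have hm : 2 * P2 1 = mC ε 1 := by
    have hcont : ContinuousAt (fun z => 2 * P2 z + (z - 1) * deriv P2 z) 1 := by
      have c1 := (hd2.continuousOn.continuousAt hUn)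
      have c2 := ((hd2.deriv hUo).continuousOn.continuousAt hUn)
      exact (c1.const_mul 2).add ((continuousAt_id.sub continuousAt_const).mul c2)
    have hcm : ContinuousAt (mC ε) 1 := by
      unfold mC
      refine ContinuousAt.div continuousAt_const (by fun_prop) ?_
      simp [hε0]
    have heq : (fun z => 2 * P2 z + (z - 1) * deriv P2 z) =ᶠ[𝓝[≠] 1] mC ε := by
      filter_upwards [self_mem_nhdsWithin, mem_nhdsWithin_of_mem_nhds hUn] with z hz hzU
      have hz' : z - 1 ≠ 0 := sub_ne_zero.2 hz
      have e1 := phiC_deriv ε hε z (hre z hzU)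
      have e2 : HasDerivAt (fun z => (z - 1) ^ 2 * P2 z) _ z :=
        (((hasDerivAt_id z).sub_const 1).pow 2).mul (hd2.differentiableAt (hUo.mem_nhds hzU)).hasDerivAt
      rw [← funext hphi] at e2
      have e3 := e1.unique e2
      simp at e3
      apply mul_left_cancel₀ hz'
      rw [e3]; ring
    have t1 := hcont.tendsto.mono_left (nhdsWithin_le_nhds (s := {1}ᶜ))
    have t2 := hcm.tendsto.mono_left (nhdsWithin_le_nhds (s := {1}ᶜ))
    have := tendsto_nhds_unique (t1.congr' heq) t2
    simpa using this
  have hm1 : mC ε 1 = (((ε - 1) / ε : ℝ) : ℂ) := by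
    unfold mC; push_cast; simp
  have hpos : 0 < (ε - 1) / ε := div_pos (by linarith) (by linarith)
  have hslit : ∀ᶠ z in 𝓝 (1:ℂ), 2 * P2 z ∈ Complex.slitPlane := by
    have c1 := ((hd2.continuousOn.continuousAt hUn).const_mul 2)
    refine c1.eventually (Complex.isOpen_slitPlane.mem_nhds ?_)
    simp only [hm, hm1]; exact Or.inl (by simpa using hpos)
  obtain ⟨R0, hR0, hb⟩ := Metric.eventually_nhds_iff_ball.1 hslit
  set R := min R0 (1/2)
  have hRU : Metric.ball (1:ℂ) R ⊆ U := Metric.ball_subset_ball (min_le_right _ _)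
  have hR0' : ∀ z ∈ Metric.ball (1:ℂ) R, 2 * P2 z ∈ Complex.slitPlane := fun z hz =>
    hb z (Metric.ball_subset_ball (min_le_left _ _) hz)
  have hreal : ∀ v : ℝ, |v - 1| < R → ∃ q : ℝ, 0 < q ∧ 2 * P2 v = (q:ℂ) := by
    intro v hv
    have hvb : (v:ℂ) ∈ Metric.ball (1:ℂ) R := by
      rw [mem_ball_iff_norm, ← Complex.ofReal_one, ← Complex.ofReal_sub, Complex.norm_real]
      simpa using hv
    have : ∃ q : ℝ, 2 * P2 v = (q:ℂ) := by
      by_cases h1 : v = 1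
      · subst h1; exact ⟨(ε - 1) / ε, by rw [Complex.ofReal_one, hm, hm1]⟩
      · refine ⟨2 * phiF ε v / (v - 1) ^ 2, ?_⟩
        have hv1 : ((v:ℂ) - 1) ≠ 0 := by
          rw [← Complex.ofReal_one, ← Complex.ofReal_sub]; exact_mod_cast sub_ne_zero.2 h1
        have hv0 : 0 < v := by simpa using hre _ (hRU hvb)
        push_cast
        rw [← phiC_ofReal ε hε v hv0, hphi]; field_simp
    obtain ⟨q, hq⟩ := this
    refine ⟨q, ?_, hq⟩
    have := hR0' _ hvb
    rw [hq] at this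
    exact Complex.ofReal_mem_slitPlane.1 this
  refine ⟨R, lt_min hR0 (by norm_num), min_le_right _ _, fun z => (2 * P2 z) ^ ((1/2 : ℝ) : ℂ),
    fun v => ((2 * P2 v).re) ^ (1/2 : ℝ), ?_, ?_, ?_, ?_⟩
  · exact ((hd2.mono hRU).const_mul 2).cpow (differentiableOn_const _) hR0'
  · intro z hz
    have : ((2 * P2 z) ^ ((1/2 : ℝ) : ℂ)) ^ 2 = 2 * P2 z := by
      rw [← Complex.cpow_nat_mul]; simp
    simp only [this, hphi]; ring
  · intro v hv
    obtain ⟨q, hq, e⟩ := hreal v hv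
    simp only [e, Complex.ofReal_re]
    refine ⟨?_, by positivity⟩
    rw [Complex.ofReal_cpow hq.le]
  · simp only [Complex.ofReal_one, hm, hm1, Complex.ofReal_re]
    rw [← rpow_natCast, ← rpow_mul hpos.le]; norm_num

lemma rpow_le_add_of_mem {l u x : ℝ} (s : ℝ) (hl : 0 < l) (h1 : l ≤ x) (h2 : x ≤ u) :
    x ^ s ≤ l ^ s + u ^ s := by
  have hx : 0 < x := hl.trans_le h1
  have hu : 0 < u := hx.trans_le h2
  rcases le_total 0 s with hs | hs
  · have := rpow_le_rpow hx.le h2 hs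
    have := rpow_nonneg hl.le s
    linarith
  · have := rpow_le_rpow_of_nonpos hl h1 hs
    have := rpow_nonneg hu.le s
    linarith

lemma dslope_bound {f : ℂ → ℂ} {c p : ℂ} {R M : ℝ} (hR : 0 < R)
    (hd : DifferentiableOn ℂ f (Metric.ball c R)) (hM : ∀ z ∈ Metric.ball c R, ‖f z‖ ≤ M)
    (hp : p ∈ Metric.ball c (R / 2)) :
    DifferentiableOn ℂ (dslope f p) (Metric.ball c R) ∧
      ∀ z ∈ Metric.ball c R, ‖dslope f p z‖ ≤ 4 * M / R := by
  have hpR : p ∈ Metric.ball c R := Metric.ball_subset_ball (by linarith) hp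
  refine ⟨(Complex.differentiableOn_dslope (Metric.isOpen_ball.mem_nhds hpR)).2 hd, ?_⟩
  intro z hz
  have hM0 : 0 ≤ M := (norm_nonneg _).trans (hM p hpR)
  have hsub : Metric.ball p (R/2) ⊆ Metric.ball c R := by
    apply Metric.ball_subset_ball'
    have := Metric.mem_ball.1 hp
    linarith
  have hdiff : ∀ z ∈ Metric.ball c R, ‖f z - f p‖ ≤ 2 * M := fun z hz =>
    (norm_sub_le _ _).trans (by linarith [hM z hz, hM p hpR])
  have he : 4 * M / R = 2 * M / (R / 2) := by field_simp; ring
  rw [he]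
  by_cases hzp : z ∈ Metric.ball p (R/2)
  · apply Complex.norm_dslope_le_div_of_mapsTo_ball (hd.mono hsub) _ hzp
    intro y hy
    rw [mem_closedBall_iff_norm]
    exact hdiff y (hsub hy)
  · have hzp' : R / 2 ≤ ‖z - p‖ := by
      rw [mem_ball_iff_norm] at hzp; linarith
    have hne : z ≠ p := by
      rintro rfl; simp at hzp'; linarith
    rw [dslope_of_ne _ hne, slope_def_field, norm_div]
    exact div_le_div₀ (by positivity) (hdiff z hz) (by positivity) hzp'

lemma real_mem_ball {v R : ℝ} (hv : |v - 1| < R) : (v:ℂ) ∈ Metric.ball (1:ℂ) R := by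
  rw [mem_ball_iff_norm, ← Complex.ofReal_one, ← Complex.ofReal_sub, Complex.norm_real]
  simpa using hv

lemma exists_r2 (ε : ℝ) (hε : 1 < ε) : ∃ R : ℝ, 0 < R ∧ R ≤ 1 / 2 ∧ ∃ rC : ℂ → ℂ, ∃ rr : ℝ → ℝ,
    ∃ ρ : ℝ, 0 < ρ ∧
    DifferentiableOn ℂ rC (Metric.ball 1 R) ∧
    (∀ z ∈ Metric.ball (1:ℂ) R, ρ / 2 ≤ ‖rC z‖ ∧ ‖rC z‖ ≤ 2 * ρ) ∧
    (∀ z ∈ Metric.ball (1:ℂ) R, HasDerivAt (fun z => (1 - z) * rC z) (- (mC ε z / rC z)) z) ∧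
    (∀ z ∈ Metric.ball (1:ℂ) R, ∀ p ∈ Metric.ball (1:ℂ) R,
      ‖((1 - z) * rC z - (1 - p) * rC p) + ρ * (z - p)‖ ≤ ρ / 2 * ‖z - p‖) ∧
    (∀ v : ℝ, |v - 1| < R → rC v = (rr v : ℂ) ∧ 0 < rr v ∧ ((1 - v) * rr v) ^ 2 = 2 * phiF ε v) ∧
    rr 1 ^ 2 = (ε - 1) / ε := by
  obtain ⟨R1, hR1, hR1h, rC, rr, hd, hsq, hreal, hr1⟩ := exists_r ε hε
  have hnh : Metric.ball (1:ℂ) R1 ∈ 𝓝 (1:ℂ) := Metric.ball_mem_nhds _ hR1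
  have hr1' : rC 1 = (rr 1 : ℂ) ∧ 0 < rr 1 := by
    have := hreal 1 (by simpa using hR1)
    simpa using this
  set ρ := rr 1 with hρ
  have hcont : ContinuousAt rC 1 := hd.continuousOn.continuousAt hnh
  have hrd := (hd.differentiableAt hnh)
  have hwd : HasDerivAt (fun z => (1 - z) * rC z) (-(ρ:ℂ)) 1 := by
    have := ((hasDerivAt_id (1:ℂ)).const_sub 1).mul hrd.hasDerivAt
    refine this.congr_deriv ?_
    simp [hr1'.1]
  have hwdo : DifferentiableOn ℂ (fun z => (1 - z) * rC z) (Metric.ball 1 R1) :=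
    DifferentiableOn.mul (by fun_prop) hd
  have hstrict : HasStrictDerivAt (fun z => (1 - z) * rC z) (-(ρ:ℂ)) 1 := by
    have h1 := (hwdo.analyticAt hnh).hasStrictDerivAt
    rwa [hwd.deriv] at h1
  have hε0 : (ε:ℂ) ≠ 0 := by exact_mod_cast (by linarith : ε ≠ 0)
  have hstr2 : ∀ᶠ q : ℂ × ℂ in 𝓝 (1, 1),
      ‖((1 - q.1) * rC q.1 - (1 - q.2) * rC q.2) + ρ * (q.1 - q.2)‖ ≤ ρ / 2 * ‖q.1 - q.2‖ := by
    have := hstrict.hasStrictFDerivAt.isLittleO.def (half_pos hr1'.2)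
    filter_upwards [this] with q hq
    refine le_trans (le_of_eq ?_) hq
    congr 1
    simp; ring
  rw [nhds_prod_eq] at hstr2
  obtain ⟨V, hV, hVp⟩ := Filter.mem_prod_self_iff.1 hstr2
  have hnb : ∀ᶠ z in 𝓝 (1:ℂ), ρ / 2 < ‖rC z‖ ∧ ‖rC z‖ < 2 * ρ := by
    have hn := hcont.norm
    have e : ‖rC 1‖ = ρ := by rw [hr1'.1, Complex.norm_real]; exact Real.norm_of_nonneg hr1'.2.le
    refine hn.eventually (Ioo_mem_nhds ?_ ?_) <;> simp only [e] <;> linarith [hr1'.2]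
  obtain ⟨R2, hR2, hR2s⟩ := Metric.mem_nhds_iff.1 (inter_mem hV hnb)
  have hs1 : Metric.ball (1:ℂ) (min R1 R2) ⊆ Metric.ball 1 R1 :=
    Metric.ball_subset_ball (min_le_left _ _)
  have hs2 : Metric.ball (1:ℂ) (min R1 R2) ⊆ Metric.ball 1 R2 :=
    Metric.ball_subset_ball (min_le_right _ _)
  refine ⟨min R1 R2, lt_min hR1 hR2, (min_le_left _ _).trans hR1h, rC, rr, ρ, hr1'.2,
    hd.mono hs1, ?_, ?_, ?_, ?_, hr1⟩
  · intro z hz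
    have := (hR2s (hs2 hz)).2
    exact ⟨this.1.le, this.2.le⟩
  · intro z hz
    have hz1 := hs1 hz
    have hrz : rC z ≠ 0 := by
      have := (hR2s (hs2 hz)).2.1
      intro h; rw [h, norm_zero] at this; linarith [hr1'.2]
    by_cases h1 : z = 1
    · subst h1
      refine hwd.congr_deriv ?_
      have hne : (ρ:ℂ) ≠ 0 := by exact_mod_cast hr1'.2.ne'
      have e : (ρ:ℂ)^2 = ((ε:ℂ) - 1) / ε := by exact_mod_cast congrArg (fun t : ℝ => (t:ℂ)) hr1
      rw [hr1'.1]
      have : mC ε 1 = (ρ:ℂ)^2 := by rw [e]; unfold mC; simp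
      rw [this]; field_simp
    · have hz' : 1 - z ≠ 0 := sub_ne_zero.2 (Ne.symm h1)
      have hzn := Metric.isOpen_ball.mem_nhds hz1
      have hdz := (hwdo.differentiableAt hzn).hasDerivAt
      have e1 := hdz.pow 2
      have e2 : HasDerivAt ((fun z => (1 - z) * rC z) ^ 2) (2 * ((z - 1) * mC ε z)) z := by
        refine ((phiC_deriv ε hε z (re_pos_of_ball (by linarith) hz1)).const_mul 2).congr_of_eventuallyEq ?_
        filter_upwards [hzn] with y hy
        simp only [Pi.pow_apply, mul_pow]
        exact hsq y hy
      have e3 := e1.unique e2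
      refine hdz.congr_deriv ?_
      simp only [Nat.cast_ofNat, Nat.add_one_sub_one, pow_one] at e3
      rw [eq_neg_iff_add_eq_zero]
      field_simp
      have : (1 - z) * (rC z * deriv (fun z => (1 - z) * rC z) z + mC ε z) = 0 := by
        linear_combination e3 / 2
      rcases mul_eq_zero.1 this with h | h
      · exact absurd h hz'
      · linear_combination h
  · intro z hz p hp
    have hm : (z, p) ∈ V ×ˢ V := Set.mk_mem_prod (hR2s (hs2 hz)).1 (hR2s (hs2 hp)).1
    have := hVp hm
    simpa only [Set.mem_setOf_eq] using this
  · intro v hv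
    have hv1 : |v - 1| < R1 := hv.trans_le (min_le_left _ _)
    obtain ⟨h1, h2⟩ := hreal v hv1
    refine ⟨h1, h2, ?_⟩
    have hvb := real_mem_ball hv1
    have := hsq _ hvb
    have hv0 : 0 < v := by simpa using re_pos_of_ball (by linarith) hvb
    rw [h1, phiC_ofReal ε hε v hv0] at this
    rw [mul_pow]
    exact_mod_cast this

noncomputable def FF (a b c ε v : ℝ) : ℝ := v ^ (c - b - 1) * (ε - 1 + v) ^ (-a)

noncomputable def FC (a b c ε : ℝ) (z : ℂ) : ℂ :=
  z ^ ((c - b - 1 : ℝ) : ℂ) * ((ε:ℂ) - 1 + z) ^ ((-a : ℝ) : ℂ)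

lemma FC_ofReal (a b c ε v : ℝ) (hε : 1 < ε) (hv : 0 < v) :
    FC a b c ε v = (FF a b c ε v : ℂ) := by
  unfold FC FF
  have : (ε:ℂ) - 1 + v = ((ε - 1 + v : ℝ) : ℂ) := by push_cast; rfl
  rw [this, ← Complex.ofReal_cpow hv.le, ← Complex.ofReal_cpow (by linarith)]
  push_cast; rfl

lemma FC_diff (a b c ε : ℝ) (hε : 1 < ε) (z : ℂ) (hz : 0 < z.re) :
    DifferentiableAt ℂ (FC a b c ε) z := by
  unfold FC
  refine DifferentiableAt.mul ?_ ?_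
  · exact differentiableAt_id.cpow (differentiableAt_const _) (Or.inl hz)
  · refine DifferentiableAt.cpow (by fun_prop) (differentiableAt_const _) (Or.inl ?_)
    simp; linarith

lemma FC_bound (a b c ε : ℝ) (hε : 1 < ε) : ∃ M : ℝ, 0 < M ∧ ∀ z ∈ Metric.ball (1:ℂ) (1/2),
    ‖FC a b c ε z * (z * ((ε:ℂ) - 1 + z) / ((ε:ℂ) - 1))‖ ≤ M := by
  have hre : ∀ z ∈ Metric.closedBall (1:ℂ) (1/2), 0 < z.re := fun z hz =>
    re_pos_of_ball (R := 1) le_rfl (Metric.closedBall_subset_ball (by norm_num) hz)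
  have hc : ContinuousOn (fun z => FC a b c ε z * (z * ((ε:ℂ) - 1 + z) / ((ε:ℂ) - 1)))
      (Metric.closedBall (1:ℂ) (1/2)) := by
    intro z hz
    refine ContinuousAt.continuousWithinAt ?_
    exact (FC_diff a b c ε hε z (hre z hz)).continuousAt.mul (by fun_prop)
  obtain ⟨M, hM⟩ := (isCompact_closedBall (1:ℂ) (1/2)).exists_bound_of_continuousOn hc
  exact ⟨max M 1, by positivity, fun z hz =>
    (hM z (Metric.ball_subset_closedBall hz)).trans (le_max_left _ _)⟩

set_option maxHeartbeats 1000000 in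
lemma key (a b c ε : ℝ) (hε : 1 < ε) : ∃ R : ℝ, 0 < R ∧ R ≤ 1 / 2 ∧ ∃ rr : ℝ → ℝ, ∃ M : ℝ, 0 < M ∧
    (∀ v : ℝ, |v - 1| < R → 0 < rr v ∧ ((1 - v) * rr v) ^ 2 = 2 * phiF ε v ∧
      HasDerivAt (fun v => (1 - v) * rr v) (-(mF ε v / rr v)) v) ∧
    rr 1 ^ 2 = (ε - 1) / ε ∧
    ∀ v0 : ℝ, |v0 - 1| < R / 2 → v0 ≠ 1 → ∀ A B : ℝ,
      A = FF a b c ε 1 * rr v0 ^ (1 - b) / rr 1 →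
      B = (A - FF a b c ε v0 * (rr v0 / mF ε v0) ^ b) / (-((1 - v0) * rr v0)) →
      |A| ≤ M ∧ |B| ≤ M ∧ ∃ k k' : ℝ → ℝ,
        (∀ v, |v - 1| < R / 2 → HasDerivAt k (k' v) v ∧ |k v| ≤ M ∧ |k' v| ≤ M) ∧
        ContinuousOn k' {v | |v - 1| < R / 2} ∧
        ∀ v, |v - 1| < R / 2 → v < v0 →
          0 < (1 - v) * rr v - (1 - v0) * rr v0 ∧
          (v0 - v) ^ (b - 1) * FF a b c ε v -
            ((1 - v) * rr v - (1 - v0) * rr v0) ^ (b - 1) * (mF ε v / rr v) *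
              (A + B * ((1 - v) * rr v)) = -((v0 - v) ^ b * ((v - 1) * mF ε v) * k v) ∧
          (v0 - v) ^ (b - 1) ≤
            M * (((1 - v) * rr v - (1 - v0) * rr v0) ^ (b - 1) * (mF ε v / rr v)) := by
  obtain ⟨R, hR, hRh, rC, rr, ρ, hρ, hd, hnb, hwd, hstr, hreal, hr1⟩ := exists_r2 ε hε
  obtain ⟨MQ, hMQ, hQ⟩ := FC_bound a b c ε hε
  set L1 : ℝ := (ρ/2) ^ (1 - b) + (3*ρ/2) ^ (1 - b) with hL1
  set L2 : ℝ := (ρ/2) ^ (b - 1) + (3*ρ/2) ^ (b - 1) with hL2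
  have hL1p : 0 < L1 := by positivity
  have hL2p : 0 < L2 := by positivity
  set MG : ℝ := MQ * (2 * ρ) * L1 with hMG
  have hMGp : 0 < MG := by positivity
  set MB : ℝ := (4 * MG / R) / (ρ / 2) with hMB
  have hMBp : 0 < MB := by positivity
  set MH : ℝ := MG + MG + MB * ρ with hMH
  have hMHp : 0 < MH := by positivity
  set MK : ℝ := L2 * (4 * (4 * MH / R) / R) / (ρ / 2) with hMK
  have hMKp : 0 < MK := by positivity
  set M5 : ℝ := L1 * (2 * ρ) * (2 * (ε - 1 + 2) / (ε - 1)) with hM5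
  have hκ : 0 < ε - 1 := by linarith
  have hM5p : 0 < M5 := by positivity
  have hε0 : (ε:ℂ) ≠ 0 := by exact_mod_cast (by linarith : ε ≠ 0)
  have hκC : (ε:ℂ) - 1 ≠ 0 := by
    rw [← Complex.ofReal_one, ← Complex.ofReal_sub]; exact_mod_cast hκ.ne'
  have hsubR : Metric.ball (1:ℂ) R ⊆ Metric.ball 1 (1/2) := Metric.ball_subset_ball hRh
  have hrep : ∀ z ∈ Metric.ball (1:ℂ) R, 0 < z.re := fun z hz => re_pos_of_ball (by linarith) hz
  have hrC0 : ∀ z ∈ Metric.ball (1:ℂ) R, rC z ≠ 0 := fun z hz h => by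
    have := (hnb z hz).1; rw [h, norm_zero] at this; linarith
  have h1b : (1:ℂ) ∈ Metric.ball (1:ℂ) R := by simpa using hR
  have hR2R : ∀ v : ℝ, |v - 1| < R / 2 → |v - 1| < R := fun v hv => by linarith
  have hvpos : ∀ v : ℝ, |v - 1| < R → 0 < v := fun v hv => by
    linarith [(abs_lt.1 hv).1]
  refine ⟨R, hR, hRh, rr, MG + MB + MK + 4 * MK / R + M5, by positivity, ?_, hr1, ?_⟩
  · intro v hv
    obtain ⟨e1, e2, e3⟩ := hreal v hv
    refine ⟨e2, e3, ?_⟩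
    have h1 := (hwd v (real_mem_ball hv)).real_of_complex
    rw [e1, mC_ofReal] at h1
    have : (-((mF ε v : ℂ) / (rr v : ℂ))).re = -(mF ε v / rr v) := by
      rw [← Complex.ofReal_div, ← Complex.ofReal_neg, Complex.ofReal_re]
    rw [this] at h1
    refine h1.congr_of_eventuallyEq ?_
    have : {v : ℝ | |v - 1| < R} ∈ 𝓝 v :=
      (isOpen_lt (by fun_prop) continuous_const).mem_nhds hv
    filter_upwards [this] with y hy
    rw [(hreal y hy).1, ← Complex.ofReal_one, ← Complex.ofReal_sub, ← Complex.ofReal_mul,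
      Complex.ofReal_re]
  intro v0 hv0 hv01 A B hA hB
  have hv0R := hR2R v0 hv0
  have hv0b := real_mem_ball hv0R
  have hv0p := hvpos v0 hv0R
  obtain ⟨er0, hr0p, -⟩ := hreal v0 hv0R
  set wC : ℂ → ℂ := fun z => (1 - z) * rC z with hwC
  have hwdo : DifferentiableOn ℂ wC (Metric.ball 1 R) := fun z hz =>
    (hwd z hz).differentiableAt.differentiableWithinAt
  set E : ℂ → ℂ := fun z => - dslope wC v0 z with hE
  have hEd : DifferentiableOn ℂ E (Metric.ball 1 R) :=
    ((Complex.differentiableOn_dslope (Metric.isOpen_ball.mem_nhds hv0b)).2 hwdo).neg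
  have hEv0 : E v0 = mC ε v0 / rC v0 := by
    simp only [hE, dslope_same, (hwd v0 hv0b).deriv, neg_neg]
  have hEb : ∀ z ∈ Metric.ball (1:ℂ) R, ‖E z - ρ‖ ≤ ρ / 2 := by
    intro z hz
    by_cases hzv : z = v0
    · subst hzv
      have hf : HasDerivAt (fun z => wC z + ρ * z) (-(mC ε v0 / rC v0) + ρ * 1) (v0:ℂ) :=
        (hwd v0 hv0b).add ((hasDerivAt_id _).const_mul _)
      have := hf.le_of_lip' (C := ρ / 2) (by positivity) (by
        filter_upwards [Metric.isOpen_ball.mem_nhds hv0b] with y hy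
        have := hstr y hy v0 hv0b
        refine le_trans (le_of_eq ?_) this
        congr 1; simp only [hwC]; ring)
      rw [hEv0, ← norm_neg]
      refine le_trans (le_of_eq ?_) this
      congr 1; ring
    · have hne : z - v0 ≠ 0 := sub_ne_zero.2 hzv
      have := hstr z hz v0 hv0b
      have e : E z - ρ = - ((((1 - z) * rC z - (1 - v0) * rC v0) + ρ * (z - v0)) / (z - v0)) := by
        simp only [hE, dslope_of_ne _ hzv, slope_def_field, hwC]
        field_simp
        ring
      rw [e, norm_neg, norm_div, div_le_iff₀ (norm_pos_iff.2 hne)]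
      exact this
  have hEre : ∀ z ∈ Metric.ball (1:ℂ) R, 0 < (E z).re := by
    intro z hz
    have h2 := (Complex.abs_re_le_norm (E z - ρ)).trans (hEb z hz)
    rw [Complex.sub_re, Complex.ofReal_re] at h2
    linarith [(abs_le.1 h2).1]
  have hE0 : ∀ z ∈ Metric.ball (1:ℂ) R, E z ≠ 0 := by
    intro z hz h
    have := hEre z hz
    rw [h] at this; simp at this
  have hEn : ∀ z ∈ Metric.ball (1:ℂ) R, ρ / 2 ≤ ‖E z‖ ∧ ‖E z‖ ≤ 3 * ρ / 2 := by
    intro z hz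
    have h := hEb z hz
    have hn : ‖(ρ:ℂ)‖ = ρ := by rw [Complex.norm_real]; exact Real.norm_of_nonneg hρ.le
    have h1 := norm_sub_norm_le (E z) (ρ:ℂ)
    have h2 := norm_sub_norm_le (ρ:ℂ) (E z)
    rw [norm_sub_rev] at h2
    rw [hn] at h1 h2
    constructor <;> linarith
  have hE1 : ∀ z ∈ Metric.ball (1:ℂ) R, ‖E z ^ ((1 - b : ℝ) : ℂ)‖ ≤ L1 := fun z hz => by
    rw [Complex.norm_cpow_real]
    exact rpow_le_add_of_mem _ (by positivity) (hEn z hz).1 (hEn z hz).2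
  have hE2 : ∀ z ∈ Metric.ball (1:ℂ) R, ‖E z ^ ((b - 1 : ℝ) : ℂ)‖ ≤ L2 := fun z hz => by
    rw [Complex.norm_cpow_real]
    exact rpow_le_add_of_mem _ (by positivity) (hEn z hz).1 (hEn z hz).2
  set GC : ℂ → ℂ := fun z => FC a b c ε z * (z * ((ε:ℂ) - 1 + z) / ((ε:ℂ) - 1)) * rC z *
    E z ^ ((1 - b : ℝ) : ℂ) with hGC
  have hGd : DifferentiableOn ℂ GC (Metric.ball 1 R) := by
    refine DifferentiableOn.mul (DifferentiableOn.mul (DifferentiableOn.mul ?_ (by fun_prop)) hd) ?_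
    · exact fun z hz => (FC_diff a b c ε hε z (hrep z hz)).differentiableWithinAt
    · exact hEd.cpow (differentiableOn_const _) (fun z hz => Or.inl (hEre z hz))
  have hGb : ∀ z ∈ Metric.ball (1:ℂ) R, ‖GC z‖ ≤ MG := by
    intro z hz
    simp only [hGC]
    rw [norm_mul, norm_mul]
    have h1 := hQ z (hsubR hz)
    have h2 := (hnb z hz).2
    have h3 := hE1 z hz
    have hMQ0 : 0 ≤ MQ := le_trans (norm_nonneg _) h1
    rw [hMG]
    exact mul_le_mul (mul_le_mul h1 h2 (norm_nonneg _) hMQ0) h3 (norm_nonneg _) (by positivity)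
  -- values
  have hmF1 : mF ε 1 = rr 1 ^ 2 := by rw [hr1]; unfold mF; simp
  have hr1p : 0 < rr 1 := (hreal 1 (by simpa using hR)).2.1
  have erC1 : rC 1 = (rr 1 : ℂ) := by simpa using (hreal 1 (by simpa using hR)).1
  have hEreal : ∀ v : ℝ, |v - 1| < R → v ≠ v0 →
      E v = ((((1 - v) * rr v - (1 - v0) * rr v0) / (v0 - v) : ℝ) : ℂ) := by
    intro v hv hne
    have hne' : (v:ℂ) ≠ v0 := by exact_mod_cast hne
    have h1 : (v:ℂ) - v0 ≠ 0 := sub_ne_zero.2 hne'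
    have h2 : (v0:ℂ) - v ≠ 0 := sub_ne_zero.2 hne'.symm
    simp only [hE, dslope_of_ne _ hne', slope_def_field, hwC, er0, (hreal v hv).1]
    push_cast
    field_simp
    ring
  have hGA : GC 1 = (A : ℂ) := by
    have e1 : E 1 = (rr v0 : ℂ) := by
      have := hEreal 1 (by simpa using hR) hv01.symm
      rw [Complex.ofReal_one] at this
      rw [this]; congr 1
      have : v0 - 1 ≠ 0 := sub_ne_zero.2 hv01
      field_simp; ring
    have e2 := FC_ofReal a b c ε 1 hε one_pos
    rw [Complex.ofReal_one] at e2
    simp only [hGC]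
    rw [e1, e2, erC1, ← Complex.ofReal_cpow hr0p.le, hA]
    have e3 : (1:ℂ) * ((ε:ℂ) - 1 + 1) / ((ε:ℂ) - 1) = ((1 / rr 1 ^ 2 : ℝ) : ℂ) := by
      rw [hr1]; push_cast; field_simp; ring
    rw [e3]
    norm_cast
    field_simp
  have hmFp : ∀ v : ℝ, 0 < v → 0 < mF ε v := fun v hv => by unfold mF; positivity
  have hGB : GC v0 = ((FF a b c ε v0 * (rr v0 / mF ε v0) ^ b : ℝ) : ℂ) := by
    simp only [hGC]
    have hm0 := hmFp v0 hv0p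
    have e3 : (v0:ℂ) * ((ε:ℂ) - 1 + v0) / ((ε:ℂ) - 1) = ((1 / mF ε v0 : ℝ) : ℂ) := by
      unfold mF; push_cast; field_simp
    rw [e3, hEv0, mC_ofReal, er0, FC_ofReal a b c ε v0 hε hv0p, ← Complex.ofReal_div,
      ← Complex.ofReal_cpow (by positivity)]
    norm_cast
    have : (mF ε v0 / rr v0) ^ (1 - b) = (mF ε v0 / rr v0) * (rr v0 / mF ε v0) ^ b := by
      rw [rpow_sub (by positivity), rpow_one, div_eq_mul_inv, ← inv_rpow (by positivity), inv_div]
    rw [this]; field_simp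
  have hAM : |A| ≤ MG := by
    have := hGb 1 h1b
    rwa [hGA, Complex.norm_real] at this
  have h1half : (1:ℂ) ∈ Metric.ball (1:ℂ) (R/2) := by simpa using hR
  have hv0half : (v0:ℂ) ∈ Metric.ball (1:ℂ) (R/2) := real_mem_ball hv0
  have hv01C : (v0:ℂ) ≠ 1 := by exact_mod_cast hv01
  have hv01C' : (v0:ℂ) - 1 ≠ 0 := sub_ne_zero.2 hv01C
  have hrr0C : (rr v0 : ℂ) ≠ 0 := by exact_mod_cast hr0p.ne'
  have hrr0n : ρ / 2 ≤ rr v0 := by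
    have := (hnb v0 hv0b).1
    rwa [er0, Complex.norm_real, Real.norm_of_nonneg hr0p.le] at this
  have hBC : (B:ℂ) = (GC v0 - GC 1) / wC v0 := by
    rw [hB, hGA, hGB]; simp only [hwC, er0]
    push_cast
    rw [div_neg, ← neg_div, neg_sub]
  have hBM : |B| ≤ MB := by
    have h1 := (dslope_bound hR hGd hGb h1half).2 v0 hv0b
    have h2 : (B:ℂ) = - (dslope GC 1 v0 / rr v0) := by
      rw [hBC, dslope_of_ne _ hv01C, slope_def_field]
      simp only [hwC, er0]
      have : (1:ℂ) - v0 ≠ 0 := sub_ne_zero.2 hv01C.symm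
      field_simp; ring
    have h3 : |B| = ‖dslope GC 1 v0‖ / rr v0 := by
      have := congrArg norm h2
      rwa [norm_neg, norm_div, Complex.norm_real, Complex.norm_real, Real.norm_of_nonneg hr0p.le] at this
    rw [h3]
    exact div_le_div₀ (by positivity) h1 (by positivity) hrr0n
  set H : ℂ → ℂ := fun z => GC z - A - B * wC z with hH
  have hHd : DifferentiableOn ℂ H (Metric.ball 1 R) :=
    (hGd.sub (differentiableOn_const _)).sub (hwdo.const_mul _)
  have hHb : ∀ z ∈ Metric.ball (1:ℂ) R, ‖H z‖ ≤ MH := by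
    intro z hz
    have h1 : ‖wC z‖ ≤ ρ := by
      simp only [hwC]
      rw [norm_mul]
      have h2 := (hnb z hz).2
      have h3 : ‖1 - z‖ ≤ 1 / 2 := by
        have := mem_ball_iff_norm.1 hz
        rw [norm_sub_rev] at this; linarith
      calc ‖1 - z‖ * ‖rC z‖ ≤ (1/2) * (2 * ρ) := by gcongr
        _ = ρ := by ring
    have h2 : ‖(A:ℂ)‖ ≤ MG := by rwa [Complex.norm_real]
    have h3 : ‖(B:ℂ) * wC z‖ ≤ MB * ρ := by
      rw [norm_mul, Complex.norm_real]
      exact mul_le_mul hBM h1 (norm_nonneg _) hMBp.le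
    exact (norm_sub_le _ _).trans (add_le_add ((norm_sub_le _ _).trans (add_le_add (hGb z hz) h2)) h3)
  have hH1 : H 1 = 0 := by simp [hH, hGA, hwC]
  have hwC0 : wC v0 ≠ 0 := by
    simp only [hwC, er0]
    exact mul_ne_zero (sub_ne_zero.2 hv01C.symm) hrr0C
  have hHv0 : H v0 = 0 := by
    simp only [hH]; rw [hBC, div_mul_cancel₀ _ hwC0, hGA]; ring
  obtain ⟨hd1, hb1⟩ := dslope_bound hR hHd hHb h1half
  obtain ⟨hd2, hb2⟩ := dslope_bound hR hd1 hb1 hv0half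
  set H2 : ℂ → ℂ := dslope (dslope H 1) v0 with hH2
  have hHf : ∀ z, H z = (z - 1) * (z - v0) * H2 z := by
    intro z
    have e1 := sub_smul_dslope H 1 z
    have e2 := sub_smul_dslope (dslope H 1) v0 z
    have e3 : dslope H 1 v0 = 0 := by
      rw [dslope_of_ne _ hv01C, slope_def_field, hH1, hHv0]; simp
    rw [e3, sub_zero, smul_eq_mul] at e2
    rw [hH1, sub_zero, smul_eq_mul] at e1
    rw [← e1, ← e2]; ring
  set kC : ℂ → ℂ := fun z => E z ^ ((b - 1 : ℝ) : ℂ) * H2 z / rC z with hkC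
  have hkd : DifferentiableOn ℂ kC (Metric.ball 1 R) :=
    ((hEd.cpow (differentiableOn_const _) (fun z hz => Or.inl (hEre z hz))).mul hd2).div hd hrC0
  have hkb : ∀ z ∈ Metric.ball (1:ℂ) R, ‖kC z‖ ≤ MK := by
    intro z hz
    simp only [hkC]
    rw [norm_div, norm_mul]
    have h1 := hE2 z hz
    have h2 := hb2 z hz
    have h3 := (hnb z hz).1
    refine div_le_div₀ (by positivity) ?_ (by positivity) h3
    exact mul_le_mul h1 h2 (norm_nonneg _) hL2p.le
  have hkdb : ∀ z ∈ Metric.ball (1:ℂ) (R/2), ‖deriv kC z‖ ≤ 4 * MK / R := by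
    intro z hz
    have := (dslope_bound hR hkd hkb hz).2 z (Metric.ball_subset_ball (by linarith) hz)
    rwa [dslope_same] at this
  have hMR : 0 < 4 * MK / R := by positivity
  refine ⟨by linarith, by linarith, fun v => (kC v).re, fun v => (deriv kC v).re, ?_, ?_, ?_⟩
  · intro v hv
    have hvb := real_mem_ball (hR2R v hv)
    refine ⟨?_, ?_, ?_⟩
    · exact ((hkd.differentiableAt (Metric.isOpen_ball.mem_nhds hvb)).hasDerivAt).real_of_complex
    · have := (Complex.abs_re_le_norm _).trans (hkb v hvb); linarith
    · have := (Complex.abs_re_le_norm _).trans (hkdb v (real_mem_ball hv)); linarith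
  · refine Complex.continuous_re.comp_continuousOn ?_
    exact (hkd.deriv Metric.isOpen_ball).continuousOn.comp (Complex.continuous_ofReal.continuousOn)
      (fun v hv => real_mem_ball (hR2R v hv))
  · intro v hv hvv
    have hvR := hR2R v hv
    have hvb := real_mem_ball hvR
    have hvp := hvpos v hvR
    obtain ⟨erv, hrvp, -⟩ := hreal v hvR
    have hEv := hEreal v hvR hvv.ne
    have hdp : 0 < v0 - v := by linarith
    set e : ℝ := ((1 - v) * rr v - (1 - v0) * rr v0) / (v0 - v) with he
    have hep : 0 < e := by
      have := hEre v hvb; rwa [hEv, Complex.ofReal_re] at this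
    have hwe : (1 - v) * rr v - (1 - v0) * rr v0 = (v0 - v) * e := by
      rw [he]; field_simp
    have hmp := hmFp v hvp
    rw [hwe]
    refine ⟨by positivity, ?_, ?_⟩
    · rw [mul_rpow hdp.le hep.le]
      have hb1 : (v0 - v) ^ b = (v0 - v) ^ (b - 1) * (v0 - v) := by
        rw [← rpow_add_one hdp.ne']; ring_nf
      rw [hb1]
      have hmain : FF a b c ε v - e ^ (b - 1) * (mF ε v / rr v) * (A + B * ((1 - v) * rr v)) =
          -((v0 - v) * ((v - 1) * mF ε v)) * (kC v).re := by
        have hC : ((FF a b c ε v - e ^ (b - 1) * (mF ε v / rr v) * (A + B * ((1 - v) * rr v)) : ℝ) : ℂ) =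
          ((-((v0 - v) * ((v - 1) * mF ε v)) : ℝ) : ℂ) * kC v := by
          have h1 := hHf v
          simp only [hH, hGC, hwC] at h1
          rw [FC_ofReal a b c ε v hε hvp, erv, hEv, ← Complex.ofReal_cpow hep.le] at h1
          simp only [hkC]
          rw [hEv, erv, ← Complex.ofReal_cpow hep.le]
          have h2 : e ^ (b - 1) * e ^ (1 - b) = 1 := by
            rw [← rpow_add hep]; simp
          have h2C : ((e ^ (b - 1) : ℝ) : ℂ) * ((e ^ (1 - b) : ℝ) : ℂ) = 1 := by exact_mod_cast h2
          have h3 : (mF ε v : ℂ) * ((v:ℂ) * ((ε:ℂ) - 1 + v) / ((ε:ℂ) - 1)) = 1 := by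
            have hvC : (v:ℂ) ≠ 0 := by exact_mod_cast hvp.ne'
            have hvC2 : (ε:ℂ) - 1 + v ≠ 0 := by
              rw [← Complex.ofReal_one, ← Complex.ofReal_sub, ← Complex.ofReal_add]
              exact_mod_cast (by linarith : ε - 1 + v ≠ 0)
            unfold mF; push_cast; field_simp
          have hrvC : (rr v : ℂ) ≠ 0 := by exact_mod_cast hrvp.ne'
          set X := ((e ^ (b - 1) : ℝ) : ℂ)
          set Y := ((e ^ (1 - b) : ℝ) : ℂ)
          set W := ((v:ℂ) * ((ε:ℂ) - 1 + v) / ((ε:ℂ) - 1))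
          push_cast
          field_simp
          linear_combination (X * (mF ε v : ℂ)) * h1 - (rr v : ℂ) * (FF a b c ε v : ℂ) * (mF ε v : ℂ) * W * h2C -
            (FF a b c ε v : ℂ) * (rr v : ℂ) * h3
        have := congrArg Complex.re hC
        rwa [Complex.ofReal_re, Complex.re_ofReal_mul] at this
      linear_combination (v0 - v) ^ (b - 1) * hmain
    · rw [mul_rpow hdp.le hep.le]
      have hen : ρ / 2 ≤ e ∧ e ≤ 3 * ρ / 2 := by
        have := hEn v hvb
        rwa [hEv, Complex.norm_real, Real.norm_of_nonneg hep.le] at this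
      have hrn : rr v ≤ 2 * ρ := by
        have := (hnb v hvb).2
        rwa [erv, Complex.norm_real, Real.norm_of_nonneg hrvp.le] at this
      have h1 : e ^ (1 - b) ≤ L1 := rpow_le_add_of_mem _ (by positivity) hen.1 hen.2
      have h2 : e ^ (b - 1) * e ^ (1 - b) = 1 := by
        rw [← rpow_add hep]; simp
      have hv2 : v ≤ 2 := by linarith [(abs_lt.1 hvR).2]
      have h3 : 1 ≤ (2 * (ε - 1 + 2) / (ε - 1)) * mF ε v := by
        unfold mF
        rw [div_mul_div_comm, le_div_iff₀ (by positivity)]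
        have : v * (ε - 1 + v) ≤ 2 * (ε - 1 + 2) := by gcongr
        nlinarith
      have h4 : 1 ≤ M5 * (e ^ (b - 1) * (mF ε v / rr v)) := by
        have hx : 0 < e ^ (b - 1) := by positivity
        have i1 : 1 ≤ L1 * e ^ (b - 1) := by
          calc (1:ℝ) = e ^ (1 - b) * e ^ (b - 1) := by rw [mul_comm]; exact h2.symm
            _ ≤ L1 * e ^ (b - 1) := mul_le_mul_of_nonneg_right h1 hx.le
        have i2 : 1 ≤ 2 * ρ * (1 / rr v) := by
          rw [mul_one_div, le_div_iff₀ hrvp]; linarith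
        calc (1:ℝ) = 1 * 1 * 1 := by ring
          _ ≤ (L1 * e ^ (b - 1)) * (2 * ρ * (1 / rr v)) * ((2 * (ε - 1 + 2) / (ε - 1)) * mF ε v) := by
            gcongr
          _ = _ := by rw [hM5]; ring
      have h5 : M5 * (e ^ (b - 1) * (mF ε v / rr v)) ≤
          (MG + MB + MK + 4 * MK / R + M5) * (e ^ (b - 1) * (mF ε v / rr v)) := by
        gcongr
        linarith
      have hx : 0 < (v0 - v) ^ (b - 1) := by positivity
      calc (v0 - v) ^ (b - 1) = (v0 - v) ^ (b - 1) * 1 := by ring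
        _ ≤ (v0 - v) ^ (b - 1) * ((MG + MB + MK + 4 * MK / R + M5) * (e ^ (b - 1) * (mF ε v / rr v))) := by
          gcongr; exact h4.trans h5
        _ = _ := by ring

lemma rpow_int_left (b w0 w1 : ℝ) (hb : 0 < b) (h : w0 < w1) :
    IntegrableOn (fun y => (y - w0) ^ (b - 1)) (Ioo w0 w1) := by
  have h1 : IntervalIntegrable (fun y : ℝ => y ^ (b - 1)) volume 0 (w1 - w0) :=
    intervalIntegral.intervalIntegrable_rpow' (by linarith)
  have h2 := h1.comp_sub_right w0
  simp only [zero_add, sub_add_cancel] at h2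
  exact (intervalIntegrable_iff_integrableOn_Ioo_of_le h.le).1 h2

lemma rpow_int_right (b w0 w1 : ℝ) (hb : 0 < b) (h : w0 < w1) :
    IntegrableOn (fun y => (w1 - y) ^ (b - 1)) (Ioo w0 w1) := by
  have h1 : IntervalIntegrable (fun y : ℝ => y ^ (b - 1)) volume (w1 - w0) 0 :=
    (intervalIntegral.intervalIntegrable_rpow' (by linarith))
  have h2 := h1.comp_sub_left w1
  simp only [sub_zero, sub_sub_cancel] at h2
  exact (intervalIntegrable_iff_integrableOn_Ioo_of_le h.le).1 h2

lemma int_mul_cont (f g : ℝ → ℝ) (u v : ℝ) (hf : IntegrableOn f (Ioo u v))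
    (hg : ContinuousOn g (Icc u v)) : IntegrableOn (fun y => f y * g y) (Ioo u v) := by
  have h1 : IntegrableOn f (Icc u v) := (integrableOn_Icc_iff_integrableOn_Ioo).2 hf
  exact (h1.mul_continuousOn hg isCompact_Icc).mono_set Ioo_subset_Icc_self

lemma local_est (b M lam v1 v0 : ℝ) (hb : 0 < b) (hM : 0 < M) (hlam : 0 < lam) (h10 : v1 < v0)
    (hd : v0 - v1 ≤ 1) (w q Φ Φ' k k' F : ℝ → ℝ) (A B : ℝ)
    (hw : ∀ v ∈ Icc v1 v0, HasDerivAt w (-(q v)) v) (hq : ∀ v ∈ Icc v1 v0, 0 < q v)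
    (hΦ : ∀ v ∈ Icc v1 v0, HasDerivAt Φ (Φ' v) v) (hΦc : ContinuousOn Φ' (Icc v1 v0))
    (hΦw : ∀ v ∈ Icc v1 v0, w v ^ 2 = 2 * Φ v)
    (hk : ∀ v ∈ Icc v1 v0, HasDerivAt k (k' v) v ∧ |k v| ≤ M ∧ |k' v| ≤ M)
    (hkc : ContinuousOn k' (Icc v1 v0)) (hF : ContinuousOn F (Icc v1 v0))
    (hid : ∀ v ∈ Ioo v1 v0, (v0 - v) ^ (b - 1) * F v -
      (w v - w v0) ^ (b - 1) * q v * (A + B * w v) = -((v0 - v) ^ b * Φ' v * k v))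
    (hle : ∀ v ∈ Ioo v1 v0, (v0 - v) ^ (b - 1) ≤ M * ((w v - w v0) ^ (b - 1) * q v)) :
    w v0 < w v1 ∧
    |(∫ v in Ioo v1 v0, (v0 - v) ^ (b - 1) * F v * exp (-lam * Φ v)) -
      (A * (∫ y in Ioo (w v0) (w v1), (y - w v0) ^ (b - 1) * exp (-lam * y ^ 2 / 2)) +
       B * (∫ y in Ioo (w v0) (w v1), (y - w v0) ^ (b - 1) * y * exp (-lam * y ^ 2 / 2)))| ≤
    M / lam * exp (-lam * Φ v1) + (b + 1) * M * M / lam *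
      (∫ y in Ioo (w v0) (w v1), (y - w v0) ^ (b - 1) * exp (-lam * y ^ 2 / 2)) := by
  have hwc : ContinuousOn w (Icc v1 v0) := fun v hv => (hw v hv).continuousAt.continuousWithinAt
  have hanti : StrictAntiOn w (Icc v1 v0) := by
    apply strictAntiOn_of_deriv_neg (convex_Icc _ _) hwc
    intro v hv
    rw [interior_Icc] at hv
    have hv' := Ioo_subset_Icc_self hv
    rw [(hw v hv').deriv]
    linarith [hq v hv']
  have hL : v1 ∈ Icc v1 v0 := left_mem_Icc.2 h10.le
  have hRm : v0 ∈ Icc v1 v0 := right_mem_Icc.2 h10.le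
  have hw01 : w v0 < w v1 := hanti hL hRm h10
  refine ⟨hw01, ?_⟩
  have himg : w '' Ioo v1 v0 = Ioo (w v0) (w v1) := by
    apply Subset.antisymm
    · rintro _ ⟨v, hv, rfl⟩
      have hv' := Ioo_subset_Icc_self hv
      exact ⟨hanti hv' hRm hv.2, hanti hL hv' hv.1⟩
    · exact intermediate_value_Ioo' h10.le hwc
  have hinj : InjOn w (Ioo v1 v0) := hanti.injOn.mono Ioo_subset_Icc_self
  have hwd : ∀ v ∈ Ioo v1 v0, HasDerivWithinAt w (-(q v)) (Ioo v1 v0) v :=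
    fun v hv => (hw v (Ioo_subset_Icc_self hv)).hasDerivWithinAt
  have hcv : ∀ g : ℝ → ℝ, (∫ y in Ioo (w v0) (w v1), g y) = ∫ v in Ioo v1 v0, q v * g (w v) := by
    intro g
    rw [← himg, integral_image_eq_integral_abs_deriv_smul measurableSet_Ioo hwd hinj]
    apply setIntegral_congr_fun measurableSet_Ioo
    intro v hv
    simp [abs_of_pos (hq v (Ioo_subset_Icc_self hv))]
  have hci : ∀ g : ℝ → ℝ, IntegrableOn g (Ioo (w v0) (w v1)) →
      IntegrableOn (fun v => q v * g (w v)) (Ioo v1 v0) := by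
    intro g hg
    rw [← himg, integrableOn_image_iff_integrableOn_abs_deriv_smul measurableSet_Ioo hwd hinj] at hg
    refine hg.congr_fun ?_ measurableSet_Ioo
    intro v hv
    simp [abs_of_pos (hq v (Ioo_subset_Icc_self hv))]
  have hΦcont : ContinuousOn Φ (Icc v1 v0) := fun v hv => (hΦ v hv).continuousAt.continuousWithinAt
  have hkcont : ContinuousOn k (Icc v1 v0) := fun v hv => (hk v hv).1.continuousAt.continuousWithinAt
  have hEc : ContinuousOn (fun v => exp (-lam * Φ v)) (Icc v1 v0) :=
    (continuousOn_const.mul hΦcont).rexp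
  set g0 : ℝ → ℝ := fun y => (y - w v0) ^ (b - 1) * exp (-lam * y ^ 2 / 2) with hg0
  set g1 : ℝ → ℝ := fun y => (y - w v0) ^ (b - 1) * y * exp (-lam * y ^ 2 / 2) with hg1
  have ig0 : IntegrableOn g0 (Ioo (w v0) (w v1)) :=
    int_mul_cont _ _ _ _ (rpow_int_left b _ _ hb hw01) (by fun_prop)
  have ig1 : IntegrableOn g1 (Ioo (w v0) (w v1)) :=
    int_mul_cont _ _ _ _ (int_mul_cont _ _ _ _ (rpow_int_left b _ _ hb hw01) (by fun_prop)) (by fun_prop)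
  have iF : IntegrableOn (fun v => (v0 - v) ^ (b - 1) * F v * exp (-lam * Φ v)) (Ioo v1 v0) :=
    int_mul_cont _ _ _ _ (int_mul_cont _ _ _ _ (rpow_int_right b _ _ hb h10) hF) hEc
  have hexp : ∀ v ∈ Ioo v1 v0, exp (-lam * w v ^ 2 / 2) = exp (-lam * Φ v) := by
    intro v hv
    rw [mul_div_assoc, hΦw v (Ioo_subset_Icc_self hv)]; congr 1; ring
  have hdiff : (∫ v in Ioo v1 v0, (v0 - v) ^ (b - 1) * F v * exp (-lam * Φ v)) -
      (A * (∫ y in Ioo (w v0) (w v1), g0 y) + B * (∫ y in Ioo (w v0) (w v1), g1 y)) =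
      ∫ v in Ioo v1 v0, -((v0 - v) ^ b * Φ' v * k v * exp (-lam * Φ v)) := by
    have isum : IntegrableOn (fun x => A * (q x * g0 (w x)) + B * (q x * g1 (w x))) (Ioo v1 v0) :=
      ((hci g0 ig0).const_mul A).add ((hci g1 ig1).const_mul B)
    rw [hcv g0, hcv g1, ← integral_const_mul, ← integral_const_mul,
      ← integral_add ((hci g0 ig0).const_mul A) ((hci g1 ig1).const_mul B),
      ← integral_sub iF isum]
    apply setIntegral_congr_fun measurableSet_Ioo
    intro v hv
    simp only [hg0, hg1, hexp v hv]
    linear_combination (exp (-lam * Φ v)) * hid v hv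
  rw [hdiff]
  set P : ℝ → ℝ := fun v => (v0 - v) ^ b * k v * exp (-lam * Φ v) with hP
  set D1 : ℝ → ℝ := fun v => (v0 - v) ^ (b - 1) * (-b * k v + (v0 - v) * k' v) * exp (-lam * Φ v) with hD1
  set D2 : ℝ → ℝ := fun v => -((v0 - v) ^ b * Φ' v * k v * exp (-lam * Φ v)) with hD2
  have hbc : ContinuousOn (fun v : ℝ => (v0 - v) ^ b) (Icc v1 v0) :=
    (by fun_prop : ContinuousOn (fun v : ℝ => v0 - v) (Icc v1 v0)).rpow_const (fun v _ => Or.inr hb.le)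
  have iD1 : IntegrableOn D1 (Ioo v1 v0) :=
    int_mul_cont _ _ _ _ (int_mul_cont _ _ _ _ (rpow_int_right b _ _ hb h10) (by fun_prop)) hEc
  have iD2 : IntegrableOn D2 (Ioo v1 v0) :=
    (((((hbc.mul hΦc).mul hkcont).mul hEc).neg).integrableOn_compact isCompact_Icc).mono_set Ioo_subset_Icc_self
  have hPd : ∀ v ∈ Ioo v1 v0, HasDerivAt P (D1 v + lam * D2 v) v := by
    intro v hv
    have hv' := Ioo_subset_Icc_self hv
    have hpos : 0 < v0 - v := by linarith [hv.2]
    have h1 : HasDerivAt (fun v : ℝ => (v0 - v) ^ b) (-1 * b * (v0 - v) ^ (b - 1)) v := by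
      have := ((hasDerivAt_id v).const_sub v0).rpow_const (p := b) (Or.inl (by simpa using hpos.ne'))
      simpa using this
    have h2 := ((hΦ v hv').const_mul (-lam)).exp
    have h3 := (h1.mul (hk v hv').1).mul h2
    refine h3.congr_deriv ?_
    simp only [hD1, hD2, Pi.mul_apply]
    have : (v0 - v) ^ b = (v0 - v) ^ (b - 1) * (v0 - v) := by
      rw [← rpow_add_one hpos.ne']; simp
    rw [this]
    ring
  have hFTC : (∫ v in Ioo v1 v0, (D1 v + lam * D2 v)) = P v0 - P v1 := by
    rw [← integral_Ioc_eq_integral_Ioo, ← intervalIntegral.integral_of_le h10.le]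
    apply intervalIntegral.integral_eq_sub_of_hasDerivAt_of_le h10.le
    · exact (hbc.mul hkcont).mul hEc
    · exact hPd
    · exact (intervalIntegrable_iff_integrableOn_Ioo_of_le h10.le).2 (iD1.add (iD2.const_mul lam))
  have hP0 : P v0 = 0 := by simp [hP, zero_rpow hb.ne']
  rw [integral_add iD1 (iD2.const_mul lam), integral_const_mul, hP0] at hFTC
  have hP1 : |P v1| ≤ M * exp (-lam * Φ v1) := by
    simp only [hP]
    rw [abs_mul, abs_mul, abs_of_pos (exp_pos _), abs_of_nonneg (rpow_nonneg (by linarith) _)]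
    have : (v0 - v1) ^ b ≤ 1 := rpow_le_one (by linarith) hd hb.le
    have h2 := (hk v1 hL).2.1
    calc _ ≤ 1 * M * exp (-lam * Φ v1) := by gcongr
      _ = _ := by ring
  have hI1 : |∫ v in Ioo v1 v0, D1 v| ≤ (b + 1) * M * M * ∫ y in Ioo (w v0) (w v1), g0 y := by
    rw [hcv g0, ← integral_const_mul]
    have : ‖∫ v in Ioo v1 v0, D1 v‖ ≤ ∫ v in Ioo v1 v0, (b + 1) * M * M * (q v * g0 (w v)) := by
      apply norm_integral_le_of_norm_le ((hci g0 ig0).const_mul _)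
      refine (ae_restrict_iff' measurableSet_Ioo).2 (ae_of_all _ ?_)
      intro v hv
      have hv' := Ioo_subset_Icc_self hv
      have hpos : 0 < v0 - v := by linarith [hv.2]
      have hle1 : v0 - v ≤ 1 := by linarith [hv.1]
      simp only [hD1, hg0, hexp v hv, Real.norm_eq_abs]
      rw [abs_mul, abs_mul, abs_of_pos (exp_pos _), abs_of_nonneg (rpow_nonneg hpos.le _)]
      have e1 : |-b * k v + (v0 - v) * k' v| ≤ (b + 1) * M := by
        refine (abs_add_le _ _).trans ?_
        rw [abs_mul, abs_mul, abs_neg, abs_of_pos hb, abs_of_pos hpos]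
        have i1 := (hk v hv').2.1
        have i2 := (hk v hv').2.2
        have i3 : (v0 - v) * |k' v| ≤ 1 * M := by gcongr
        have i4 : b * |k v| ≤ b * M := by gcongr
        linarith
      have e2 := hle v hv
      have e3 : 0 ≤ (v0 - v) ^ (b - 1) := rpow_nonneg hpos.le _
      calc _ ≤ (M * ((w v - w v0) ^ (b - 1) * q v)) * ((b + 1) * M) * exp (-lam * Φ v) := by
            gcongr
            exact e3.trans e2
        _ = _ := by ring
    simpa [Real.norm_eq_abs] using this
  have hfin : (∫ v in Ioo v1 v0, D2 v) = (-P v1 - ∫ v in Ioo v1 v0, D1 v) / lam := by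
    field_simp; linarith
  rw [hfin, abs_div, abs_of_pos hlam, div_le_iff₀ hlam]
  calc |-P v1 - ∫ v in Ioo v1 v0, D1 v| ≤ |P v1| + |∫ v in Ioo v1 v0, D1 v| := by
        have := abs_sub (-P v1) (∫ v in Ioo v1 v0, D1 v); rwa [abs_neg] at this
    _ ≤ M * exp (-lam * Φ v1) + (b + 1) * M * M * ∫ y in Ioo (w v0) (w v1), g0 y := add_le_add hP1 hI1
    _ = _ := by field_simp

lemma shift_int (w0 : ℝ) (g : ℝ → ℝ) :
    (∫ y in Ioi w0, g y) = ∫ s in Ioi (0:ℝ), g (s + w0) := by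
  have := (measurePreserving_add_right volume w0).setIntegral_preimage_emb
    (measurableEmbedding_addRight w0) g (Ioi w0)
  rw [← this]; simp

lemma shift_intOn (w0 : ℝ) (g : ℝ → ℝ) :
    IntegrableOn g (Ioi w0) ↔ IntegrableOn (fun s => g (s + w0)) (Ioi (0:ℝ)) := by
  have := (measurePreserving_add_right volume w0).integrableOn_comp_preimage
    (measurableEmbedding_addRight w0) (f := g) (s := Ioi w0)
  rw [← this]; simp [Function.comp_def]

lemma S_scale (b lam w0 : ℝ) (k : ℕ) (hlam : 0 < lam) :
    lam ^ (-(b + k) / 2) * S b k (-w0 * Real.sqrt lam) =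
      1 / Gamma b * ∫ y in Ioi w0, (y - w0) ^ (b - 1) * y ^ k * exp (-lam * y ^ 2 / 2) := by
  unfold S
  have hs : 0 < Real.sqrt lam := Real.sqrt_pos.2 hlam
  have hs2 : Real.sqrt lam ^ 2 = lam := Real.sq_sqrt hlam.le
  rw [shift_int w0]
  have h := integral_comp_mul_left_Ioi (fun τ : ℝ => τ ^ (b - 1) * (τ - -w0 * Real.sqrt lam) ^ k *
    Real.exp (-(τ - -w0 * Real.sqrt lam) ^ 2 / 2)) 0 hs
  rw [mul_zero, smul_eq_mul] at h
  have h' : (∫ τ in Ioi (0:ℝ), τ ^ (b - 1) * (τ - -w0 * Real.sqrt lam) ^ k *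
    Real.exp (-(τ - -w0 * Real.sqrt lam) ^ 2 / 2)) = Real.sqrt lam * ((Real.sqrt lam) ^ (b - 1) *
      (Real.sqrt lam) ^ k * ∫ s in Ioi (0:ℝ), (s + w0 - w0) ^ (b - 1) * (s + w0) ^ k *
        exp (-lam * (s + w0) ^ 2 / 2)) := by
    rw [← integral_const_mul]
    have e : (∫ s in Ioi (0:ℝ), (Real.sqrt lam) ^ (b - 1) *
      (Real.sqrt lam) ^ k * ((s + w0 - w0) ^ (b - 1) * (s + w0) ^ k *
        exp (-lam * (s + w0) ^ 2 / 2))) = ∫ x in Ioi (0:ℝ), (Real.sqrt lam * x) ^ (b - 1) *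
          (Real.sqrt lam * x - -w0 * Real.sqrt lam) ^ k *
          Real.exp (-(Real.sqrt lam * x - -w0 * Real.sqrt lam) ^ 2 / 2) := by
      apply setIntegral_congr_fun measurableSet_Ioi
      intro s hsp
      have hsp' : (0:ℝ) < s := hsp
      simp only
      rw [mul_rpow hs.le hsp'.le]
      have e1 : Real.sqrt lam * s - -w0 * Real.sqrt lam = Real.sqrt lam * (s + w0) := by ring
      rw [e1, mul_pow, mul_pow, hs2, add_sub_cancel_right]
      rw [show -(lam * (s + w0) ^ 2) / 2 = -lam * (s + w0) ^ 2 / 2 by ring]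
      ring
    rw [e, h]
    field_simp
  rw [h']
  have hp : lam ^ (-(b + k) / 2) * (Real.sqrt lam * (Real.sqrt lam ^ (b - 1) * Real.sqrt lam ^ k)) = 1 := by
    have e1 : Real.sqrt lam * (Real.sqrt lam ^ (b - 1) * Real.sqrt lam ^ k) = Real.sqrt lam ^ (b + k) := by
      rw [← rpow_natCast, ← rpow_add hs]
      nth_rw 1 [← rpow_one (Real.sqrt lam)]
      rw [← rpow_add hs]; congr 1; ring
    rw [e1, Real.sqrt_eq_rpow, ← rpow_mul hlam.le, ← rpow_add hlam]
    rw [show -(b + (k:ℝ)) / 2 + 1 / 2 * (b + k) = 0 by ring, rpow_zero]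
  set I := ∫ s in Ioi (0:ℝ), (s + w0 - w0) ^ (b - 1) * (s + w0) ^ k * exp (-lam * (s + w0) ^ 2 / 2)
  linear_combination (1 / Gamma b * I) * hp

lemma J_base (b : ℝ) (hb : 0 < b) : ∃ C > 0, ∀ w0 : ℝ, |w0| ≤ 1 →
    IntegrableOn (fun y => (y - w0) ^ (b - 1) * (1 + |y|) * exp (-y ^ 2 / 2)) (Ioi w0) ∧
    (∫ y in Ioi w0, (y - w0) ^ (b - 1) * (1 + |y|) * exp (-y ^ 2 / 2)) ≤ C := by
  set D : ℝ → ℝ := fun s => exp (1 / 2) * (2 * (s ^ (b - 1) * exp (-(1 / 4) * s ^ 2)) +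
    s ^ b * exp (-(1 / 4) * s ^ 2)) with hD
  have iD : IntegrableOn D (Ioi 0) :=
    (((integrableOn_rpow_mul_exp_neg_mul_sq (by norm_num) (by linarith)).const_mul 2).add
      (integrableOn_rpow_mul_exp_neg_mul_sq (by norm_num) (by linarith))).const_mul _
  refine ⟨|∫ s in Ioi (0:ℝ), D s| + 1, by positivity, ?_⟩
  intro w0 hw0
  have hbd : ∀ s ∈ Ioi (0:ℝ), (s + w0 - w0) ^ (b - 1) * (1 + |s + w0|) * exp (-(s + w0) ^ 2 / 2) ≤ D s := by
    intro s hs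
    have hs' : (0:ℝ) < s := hs
    have hw := abs_le.1 hw0
    simp only [hD]
    have e1 : s ^ b = s ^ (b - 1) * s := by rw [← rpow_add_one hs'.ne']; simp
    have e2 : exp (-(s + w0) ^ 2 / 2) ≤ exp (1 / 2) * exp (-(1 / 4) * s ^ 2) := by
      rw [← exp_add]; apply exp_le_exp.2
      nlinarith [sq_nonneg (s + 2 * w0)]
    have e3 : |s + w0| ≤ s + 1 := (abs_add_le _ _).trans (by rw [abs_of_pos hs']; linarith)
    rw [add_sub_cancel_right, e1]
    have e4 : 0 < s ^ (b - 1) := by positivity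
    calc _ ≤ s ^ (b - 1) * (1 + (s + 1)) * (exp (1 / 2) * exp (-(1 / 4) * s ^ 2)) := by gcongr
      _ = _ := by ring
  have hmeas : IntegrableOn (fun s => (s + w0 - w0) ^ (b - 1) * (1 + |s + w0|) * exp (-(s + w0) ^ 2 / 2)) (Ioi 0) := by
    apply Integrable.mono' iD
    · apply Measurable.aestronglyMeasurable
      fun_prop
    · refine (ae_restrict_iff' measurableSet_Ioi).2 (ae_of_all _ ?_)
      intro s hs
      have hs' : (0:ℝ) < s := hs
      rw [Real.norm_of_nonneg]
      · exact hbd s hs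
      · have : 0 < s + w0 - w0 := by linarith
        positivity
  refine ⟨(shift_intOn _ _).2 hmeas, ?_⟩
  rw [shift_int]
  have := setIntegral_mono_on hmeas iD measurableSet_Ioi hbd
  linarith [le_abs_self (∫ s in Ioi (0:ℝ), D s)]

lemma J_tail (b : ℝ) (hb : 0 < b) : ∃ C > 0, ∀ w0 lam w1 : ℝ, |w0| ≤ 1 → 1 ≤ lam → 0 < w1 → w0 < w1 →
    IntegrableOn (fun y => (y - w0) ^ (b - 1) * exp (-lam * y ^ 2 / 2)) (Ioi w0) ∧
    IntegrableOn (fun y => (y - w0) ^ (b - 1) * y * exp (-lam * y ^ 2 / 2)) (Ioi w0) ∧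
    |∫ y in Ioi w1, (y - w0) ^ (b - 1) * exp (-lam * y ^ 2 / 2)| ≤ C * exp (-(lam - 1) * (w1 ^ 2 / 2)) ∧
    |∫ y in Ioi w1, (y - w0) ^ (b - 1) * y * exp (-lam * y ^ 2 / 2)| ≤ C * exp (-(lam - 1) * (w1 ^ 2 / 2)) := by
  obtain ⟨C, hC, h⟩ := J_base b hb
  refine ⟨C, hC, ?_⟩
  intro w0 lam w1 hw0 hlam hw1 hw01
  obtain ⟨hi, hI⟩ := h w0 hw0
  have hsub : Ioi w1 ⊆ Ioi w0 := Ioi_subset_Ioi hw01.le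
  have hpos : ∀ y ∈ Ioi w0, 0 ≤ (y - w0) ^ (b - 1) * (1 + |y|) * exp (-y ^ 2 / 2) := by
    intro y hy
    have : 0 < y - w0 := sub_pos.2 hy
    positivity
  have hmain : ∀ (f : ℝ → ℝ), Measurable f → (∀ y, |f y| ≤ 1 + |y|) →
      IntegrableOn (fun y => (y - w0) ^ (b - 1) * f y * exp (-lam * y ^ 2 / 2)) (Ioi w0) ∧
      |∫ y in Ioi w1, (y - w0) ^ (b - 1) * f y * exp (-lam * y ^ 2 / 2)| ≤
        C * exp (-(lam - 1) * (w1 ^ 2 / 2)) := by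
    intro f hfm hf
    constructor
    · apply Integrable.mono' hi
      · apply Measurable.aestronglyMeasurable
        fun_prop
      · refine (ae_restrict_iff' measurableSet_Ioi).2 (ae_of_all _ ?_)
        intro y hy
        have hy' : 0 < y - w0 := sub_pos.2 hy
        rw [norm_mul, norm_mul, Real.norm_of_nonneg (rpow_nonneg hy'.le _), Real.norm_of_nonneg (exp_pos _).le,
          Real.norm_eq_abs]
        have := hf y
        have : exp (-lam * y ^ 2 / 2) ≤ exp (-y ^ 2 / 2) := exp_le_exp.2 (by nlinarith [sq_nonneg y])
        gcongr
    · have hb1 : ‖∫ y in Ioi w1, (y - w0) ^ (b - 1) * f y * exp (-lam * y ^ 2 / 2)‖ ≤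
          ∫ y in Ioi w1, exp (-(lam - 1) * (w1 ^ 2 / 2)) * ((y - w0) ^ (b - 1) * (1 + |y|) * exp (-y ^ 2 / 2)) := by
        apply norm_integral_le_of_norm_le ((hi.mono_set hsub).const_mul _)
        refine (ae_restrict_iff' measurableSet_Ioi).2 (ae_of_all _ ?_)
        intro y hy
        have hy' : 0 < y - w0 := sub_pos.2 (hsub hy)
        have hy1 : w1 < y := hy
        rw [norm_mul, norm_mul, Real.norm_of_nonneg (rpow_nonneg hy'.le _), Real.norm_of_nonneg (exp_pos _).le,
          Real.norm_eq_abs]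
        have h1 := hf y
        have h2 : exp (-lam * y ^ 2 / 2) ≤ exp (-(lam - 1) * (w1 ^ 2 / 2)) * exp (-y ^ 2 / 2) := by
          rw [← exp_add]; apply exp_le_exp.2
          have : w1 ^ 2 ≤ y ^ 2 := by gcongr
          nlinarith
        have h3 : 0 ≤ (y - w0) ^ (b - 1) := rpow_nonneg hy'.le _
        calc _ ≤ (y - w0) ^ (b - 1) * (1 + |y|) * (exp (-(lam - 1) * (w1 ^ 2 / 2)) * exp (-y ^ 2 / 2)) := by
              gcongr
          _ = _ := by ring
      rw [Real.norm_eq_abs, integral_const_mul] at hb1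
      refine hb1.trans ?_
      rw [mul_comm]
      gcongr
      refine le_trans ?_ hI
      exact setIntegral_mono_set hi ((ae_restrict_iff' measurableSet_Ioi).2 (ae_of_all _ hpos)) hsub.eventuallyLE
  have h0 := hmain (fun _ => 1) (by fun_prop) (fun y => by rw [abs_one]; linarith [abs_nonneg y])
  have h1 := hmain (fun y => y) (by fun_prop) (fun y => by linarith)
  simp only [mul_one] at h0
  exact ⟨h0.1, h1.1, h0.2, h1.2⟩

lemma J_lower (b w1 : ℝ) (hw1 : 0 < w1) : ∃ c0 > 0, ∀ w0 lam : ℝ, |w0| ≤ w1 / 8 → 0 < lam →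
    IntegrableOn (fun y => (y - w0) ^ (b - 1) * exp (-lam * y ^ 2 / 2)) (Ioi w0) →
    c0 * exp (-lam * (w1 ^ 2 / 8)) ≤ ∫ y in Ioi w0, (y - w0) ^ (b - 1) * exp (-lam * y ^ 2 / 2) := by
  set L := (w1 / 8) ^ (1 - b) + w1 ^ (1 - b) with hL
  have hLp : 0 < L := by positivity
  refine ⟨w1 / 4 * L⁻¹, by positivity, ?_⟩
  intro w0 lam hw0 hlam hi
  have hw := abs_le.1 hw0
  have hsub : Ioo (w1 / 4) (w1 / 2) ⊆ Ioi w0 := fun y hy => by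
    have := hy.1
    simp only [mem_Ioi]; linarith
  have h1 : (∫ y in Ioo (w1 / 4) (w1 / 2), L⁻¹ * exp (-lam * (w1 ^ 2 / 8))) ≤
      ∫ y in Ioo (w1 / 4) (w1 / 2), (y - w0) ^ (b - 1) * exp (-lam * y ^ 2 / 2) := by
    apply setIntegral_mono_on ((continuousOn_const.integrableOn_Icc).mono_set Ioo_subset_Icc_self) (hi.mono_set hsub) measurableSet_Ioo
    intro y hy
    have hy0 : 0 < y - w0 := sub_pos.2 (hsub hy)
    have i1 : w1 / 8 ≤ y - w0 := by linarith [hy.1]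
    have i2 : y - w0 ≤ w1 := by linarith [hy.2]
    have i3 := rpow_le_add_of_mem (1 - b) (by positivity : 0 < w1 / 8) i1 i2
    have i4 : L⁻¹ ≤ (y - w0) ^ (b - 1) := by
      rw [show b - 1 = -(1 - b) by ring, rpow_neg hy0.le]
      exact inv_anti₀ (by positivity) i3
    have i5 : exp (-lam * (w1 ^ 2 / 8)) ≤ exp (-lam * y ^ 2 / 2) := by
      apply exp_le_exp.2
      have hyp : 0 < y := by linarith [hy.1]
      have : y ^ 2 ≤ (w1 / 2) ^ 2 := by gcongr; exact hy.2.le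
      nlinarith
    gcongr
  have h2 : (∫ y in Ioo (w1 / 4) (w1 / 2), (y - w0) ^ (b - 1) * exp (-lam * y ^ 2 / 2)) ≤
      ∫ y in Ioi w0, (y - w0) ^ (b - 1) * exp (-lam * y ^ 2 / 2) := by
    apply setIntegral_mono_set hi _ hsub.eventuallyLE
    refine (ae_restrict_iff' measurableSet_Ioi).2 (ae_of_all _ ?_)
    intro y hy
    have : 0 < y - w0 := sub_pos.2 hy
    simp only [Pi.zero_apply]
    positivity
  refine le_trans (le_of_eq ?_) (h1.trans h2)
  rw [setIntegral_const, smul_eq_mul, Real.volume_real_Ioo_of_le (by linarith)]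
  ring

lemma J_comb (b w0 lam : ℝ) (hw0 : -(1 / 2) ≤ w0)
    (h0 : IntegrableOn (fun y => (y - w0) ^ (b - 1) * exp (-lam * y ^ 2 / 2)) (Ioi w0))
    (h1 : IntegrableOn (fun y => (y - w0) ^ (b - 1) * y * exp (-lam * y ^ 2 / 2)) (Ioi w0)) :
    (∫ y in Ioi w0, (y - w0) ^ (b - 1) * exp (-lam * y ^ 2 / 2)) ≤
      2 * ((∫ y in Ioi w0, (y - w0) ^ (b - 1) * exp (-lam * y ^ 2 / 2)) +
        ∫ y in Ioi w0, (y - w0) ^ (b - 1) * y * exp (-lam * y ^ 2 / 2)) := by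
  rw [← integral_add h0 h1, ← integral_const_mul]
  apply setIntegral_mono_on h0 ((h0.add h1).const_mul 2) measurableSet_Ioi
  intro y hy
  have hy0 : 0 < y - w0 := sub_pos.2 hy
  have : 0 ≤ (y - w0) ^ (b - 1) * exp (-lam * y ^ 2 / 2) := by positivity
  simp only [Pi.add_apply]
  have hy1 : 0 ≤ y + 1 / 2 := by linarith
  nlinarith [mul_nonneg this hy1]

lemma phiF_deriv (ε v : ℝ) (hε : 1 < ε) (hv : 0 < v) : HasDerivAt (phiF ε) ((v - 1) * mF ε v) v := by
  have h0 : 0 < ε - 1 + v := by linarith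
  have h1 : HasDerivAt (fun v : ℝ => (ε - 1 + v) / ε) (1 / ε) v :=
    ((hasDerivAt_id v).const_add (ε - 1)).div_const ε
  have h2 := (h1.log (by positivity)).const_mul ε
  have h3 := h2.sub (Real.hasDerivAt_log hv.ne')
  refine h3.congr_deriv ?_
  unfold mF
  field_simp
  ring

lemma phiF_anti (ε : ℝ) (hε : 1 < ε) : AntitoneOn (phiF ε) (Ioc 0 1) := by
  apply antitoneOn_of_deriv_nonpos (convex_Ioc _ _)
  · exact fun v hv => (phiF_deriv ε v hε hv.1).continuousAt.continuousWithinAt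
  · rw [interior_Ioc]
    exact fun v hv => (phiF_deriv ε v hε hv.1).differentiableAt.differentiableWithinAt
  · rw [interior_Ioc]
    intro v hv
    rw [(phiF_deriv ε v hε hv.1).deriv]
    have : 0 < mF ε v := by
      unfold mF
      have h0 : 0 < ε - 1 + v := by linarith [hv.1]
      have := hv.1
      have : 0 < ε - 1 := by linarith
      positivity
    nlinarith [hv.2]

lemma FF_cont (a b c ε v : ℝ) (hε : 1 < ε) (hv : 0 < v) : ContinuousAt (FF a b c ε) v := by
  unfold FF
  have h0 : ε - 1 + v ≠ 0 := by linarith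
  exact (continuousAt_id.rpow_const (Or.inl hv.ne')).mul
    ((continuousAt_const.add continuousAt_id).rpow_const (Or.inl h0))

lemma tail1 (a b c ε v1 g : ℝ) (hb : 0 < b) (hε : 1 < ε) (hv1 : 0 < v1) (hv1' : v1 < 1) (hg : 0 < g) :
    ∃ C > 0, ∃ l1 > 0, ∀ v0 lam : ℝ, g ≤ v0 - v1 → v0 ≤ 2 → l1 ≤ lam →
      IntegrableOn (fun v => (v0 - v) ^ (b - 1) * FF a b c ε v * exp (-lam * phiF ε v)) (Ioc 0 v1) ∧
      |∫ v in Ioc 0 v1, (v0 - v) ^ (b - 1) * FF a b c ε v * exp (-lam * phiF ε v)| ≤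
        C * exp (-(lam - l1) * phiF ε v1) := by
  set l1 := |c| + b + 1 with hl1
  have hl1p : 0 < l1 := by positivity
  have hκ : 0 < ε - 1 := by linarith
  set C1 := g ^ (b - 1) + 2 ^ (b - 1) with hC1
  set C2 := (ε - 1) ^ (-a) + ε ^ (-a) with hC2
  set C3 := ((ε - 1) / ε) ^ (-(ε * l1)) with hC3
  have hC1p : 0 < C1 := by positivity
  have hC2p : 0 < C2 := by positivity
  have hC3p : 0 < C3 := by positivity
  refine ⟨C1 * C2 * C3, by positivity, l1, hl1p, ?_⟩
  intro v0 lam hg0 hv02 hlam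
  have hbd : ∀ v ∈ Ioc 0 v1, ‖(v0 - v) ^ (b - 1) * FF a b c ε v * exp (-lam * phiF ε v)‖ ≤
      C1 * C2 * C3 * exp (-(lam - l1) * phiF ε v1) := by
    intro v hv
    have hvp := hv.1
    have hv1le : v ≤ 1 := by linarith [hv.2]
    have hd : 0 < v0 - v := by linarith [hv.2]
    have hk : 0 < ε - 1 + v := by linarith
    have e1 : (v0 - v) ^ (b - 1) ≤ C1 := rpow_le_add_of_mem _ hg (by linarith [hv.2]) (by linarith)
    have e2 : (ε - 1 + v) ^ (-a) ≤ C2 := rpow_le_add_of_mem _ hκ (by linarith) (by linarith)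
    have e3 : exp (-l1 * phiF ε v) ≤ C3 * v ^ l1 := by
      have : exp (-l1 * phiF ε v) = ((ε - 1 + v) / ε) ^ (-(ε * l1)) * v ^ l1 := by
        rw [rpow_def_of_pos (by positivity), rpow_def_of_pos hvp, ← exp_add]
        unfold phiF; congr 1; ring
      rw [this]
      gcongr
      apply rpow_le_rpow_of_nonpos (by positivity)
      · gcongr; linarith
      · have : 0 < ε * l1 := by positivity
        linarith
    have e4 : v ^ (c - b - 1) * v ^ l1 ≤ 1 := by
      rw [← rpow_add hvp]
      apply rpow_le_one hvp.le hv1le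
      have := neg_abs_le c
      linarith
    have e5 : exp (-lam * phiF ε v) ≤ exp (-(lam - l1) * phiF ε v1) * exp (-l1 * phiF ε v) := by
      rw [← exp_add]; apply exp_le_exp.2
      have := phiF_anti ε hε (⟨hvp, hv1le⟩ : v ∈ Ioc (0:ℝ) 1) (⟨hv1, hv1'.le⟩ : v1 ∈ Ioc (0:ℝ) 1) hv.2
      nlinarith
    unfold FF
    rw [Real.norm_of_nonneg (by positivity)]
    have e6 : exp (-lam * phiF ε v) ≤ exp (-(lam - l1) * phiF ε v1) * (C3 * v ^ l1) :=
      e5.trans (by gcongr)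
    calc _ ≤ C1 * (v ^ (c - b - 1) * C2) * (exp (-(lam - l1) * phiF ε v1) * (C3 * v ^ l1)) := by gcongr
      _ = C1 * C2 * C3 * exp (-(lam - l1) * phiF ε v1) * (v ^ (c - b - 1) * v ^ l1) := by ring
      _ ≤ C1 * C2 * C3 * exp (-(lam - l1) * phiF ε v1) * 1 := by gcongr
      _ = _ := by ring
  constructor
  · apply Measure.integrableOn_of_bounded (M := C1 * C2 * C3 * exp (-(lam - l1) * phiF ε v1)) (by simp)
    · apply Measurable.aestronglyMeasurable
      unfold FF phiF
      fun_prop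
    · exact (ae_restrict_iff' measurableSet_Ioc).2 (ae_of_all _ hbd)
  · have h := norm_setIntegral_le_of_norm_le_const (μ := volume) (s := Ioc 0 v1) (by simp) hbd
    rw [Real.norm_eq_abs, Real.volume_real_Ioc_of_le hv1.le] at h
    refine h.trans ?_
    have : C1 * C2 * C3 * exp (-(lam - l1) * phiF ε v1) * (v1 - 0) ≤
      C1 * C2 * C3 * exp (-(lam - l1) * phiF ε v1) * 1 := by
      gcongr; linarith
    linarith

lemma exp_absorb (μ l lam c0 J : ℝ) (hμ : 0 < μ) (hlam : 0 < lam) (hc0 : 0 < c0)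
    (hJ : c0 * exp (-lam * (μ / 4)) ≤ J) :
    exp (-(lam - l) * μ) ≤ exp (l * μ) * (4 / (3 * μ * c0)) / lam * J := by
  have h1 : exp (-(lam - l) * μ) = exp (l * μ) * exp (-(3 / 4 * lam * μ)) * exp (-lam * (μ / 4)) := by
    rw [← exp_add, ← exp_add]; congr 1; ring
  have h2 : exp (-(3 / 4 * lam * μ)) ≤ 4 / (3 * μ * lam) := by
    rw [exp_neg, inv_le_comm₀ (exp_pos _) (by positivity), inv_div]
    have := add_one_le_exp (3 / 4 * lam * μ)
    have e : 3 * μ * lam / 4 = 3 / 4 * lam * μ := by ring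
    rw [e]; linarith
  have h3 : exp (-lam * (μ / 4)) ≤ J / c0 := by rw [le_div_iff₀ hc0]; linarith
  rw [h1]
  calc _ ≤ exp (l * μ) * (4 / (3 * μ * lam)) * (J / c0) := by gcongr
    _ = _ := by field_simp

lemma main_v (a b c ε : ℝ) (hb : 0 < b) (hε : 1 < ε) : ∃ η : ℝ, 0 < η ∧ η ≤ 1 / 2 ∧
    ∃ rr : ℝ → ℝ, ∃ C : ℝ, 0 < C ∧ ∃ l0 : ℝ, 1 ≤ l0 ∧ 0 < rr 1 ∧ rr 1 ^ 2 = (ε - 1) / ε ∧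
    ∀ v0 : ℝ, |v0 - 1| ≤ η → v0 ≠ 1 → 0 < rr v0 ∧ ((1 - v0) * rr v0) ^ 2 = 2 * phiF ε v0 ∧
    ∀ A B : ℝ, A = FF a b c ε 1 * rr v0 ^ (1 - b) / rr 1 →
      B = (A - FF a b c ε v0 * (rr v0 / mF ε v0) ^ b) / (-((1 - v0) * rr v0)) →
    ∀ w0 : ℝ, w0 = (1 - v0) * rr v0 → ∀ lam : ℝ, l0 ≤ lam →
    |(∫ v in Ioo 0 v0, (v0 - v) ^ (b - 1) * FF a b c ε v * exp (-lam * phiF ε v)) -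
      (A * (∫ y in Ioi w0, (y - w0) ^ (b - 1) * exp (-lam * y ^ 2 / 2)) +
       B * (∫ y in Ioi w0, (y - w0) ^ (b - 1) * y * exp (-lam * y ^ 2 / 2)))| ≤
      C / lam * ((∫ y in Ioi w0, (y - w0) ^ (b - 1) * exp (-lam * y ^ 2 / 2)) +
        ∫ y in Ioi w0, (y - w0) ^ (b - 1) * y * exp (-lam * y ^ 2 / 2)) := by
  obtain ⟨R, hR, hRh, rr, M, hM, hrr, hr1, hkey⟩ := key a b c ε hε
  have hr1p : 0 < rr 1 := (hrr 1 (by simpa using hR)).1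
  have hv1R : |(1 - R / 4) - 1| < R := by
    rw [abs_lt]; constructor <;> linarith
  obtain ⟨v1, hv1⟩ : ∃ v1, v1 = 1 - R / 4 := ⟨_, rfl⟩
  rw [← hv1] at hv1R
  obtain ⟨w, hw⟩ : ∃ w : ℝ → ℝ, w = fun v => (1 - v) * rr v := ⟨_, rfl⟩
  have hwv : ∀ v, (1 - v) * rr v = w v := fun v => by rw [hw]
  simp only [hwv] at hrr hkey ⊢
  have hw1 : 0 < w v1 := by
    rw [hw]; simp only; have := (hrr v1 hv1R).1
    have : 0 < 1 - v1 := by rw [hv1]; linarith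
    positivity
  have hw11 : w 1 = 0 := by rw [hw]; simp
  have hμ : phiF ε v1 = w v1 ^ 2 / 2 := by have := (hrr v1 hv1R).2.1; linarith
  obtain ⟨μ, hμd⟩ : ∃ μ, μ = w v1 ^ 2 / 2 := ⟨_, rfl⟩
  have hμp : 0 < μ := by rw [hμd]; positivity
  have hev : ∀ᶠ v in 𝓝 (1:ℝ), |w v| < min (w v1 / 8) (1 / 2) := by
    have hc : ContinuousAt (fun v => |w v|) 1 := by
      have := (hrr 1 (by simpa using hR)).2.2.continuousAt
      exact this.abs
    apply hc.eventually_lt_const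
    simp only [hw11, abs_zero]; positivity
  obtain ⟨η', hη', hball⟩ := Metric.eventually_nhds_iff.1 hev
  obtain ⟨C1, hC1, l1, hl1, htail1⟩ := tail1 a b c ε v1 (R / 8) hb hε (by rw [hv1]; linarith)
    (by rw [hv1]; linarith) (by linarith)
  obtain ⟨C2, hC2, htail2⟩ := J_tail b hb
  obtain ⟨c0, hc0, hlow⟩ := J_lower b (w v1) hw1
  obtain ⟨D, hD⟩ : ∃ D : ℝ → ℝ, D = fun l => exp (l * μ) * (4 / (3 * μ * c0)) := ⟨_, rfl⟩
  have hDp : ∀ l, 0 < D l := fun l => by rw [hD]; positivity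
  obtain ⟨CC, hCC⟩ : ∃ CC, CC = C1 * D l1 + M * D 0 + (b + 1) * M * M + 2 * M * C2 * D 1 := ⟨_, rfl⟩
  have hCCp : 0 < CC := by
    have := hDp l1
    have := hDp 0
    have := hDp 1
    rw [hCC]; positivity
  refine ⟨min (η' / 2) (R / 8), by positivity, (min_le_right _ _).trans (by linarith), rr,
    2 * CC, by positivity, max 1 l1, le_max_left _ _, hr1p, hr1, ?_⟩
  intro v0 hv0 hne
  simp only [hwv]
  have hv0R : |v0 - 1| ≤ R / 8 := hv0.trans (min_le_right _ _)
  have hv0R' := abs_le.1 hv0R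
  have hsm : |w v0| < min (w v1 / 8) (1 / 2) := by
    apply hball
    rw [Real.dist_eq]
    have := hv0.trans (min_le_left _ _)
    linarith
  have hs1 : |w v0| < w v1 / 8 := hsm.trans_le (min_le_left _ _)
  have hs2 : |w v0| < 1 / 2 := hsm.trans_le (min_le_right _ _)
  refine ⟨(hrr v0 (by linarith)).1, (hrr v0 (by linarith)).2.1, ?_⟩
  intro A B hA hB w0 hw0 lam hlam
  subst hw0
  have hlam1 : 1 ≤ lam := (le_max_left _ _).trans hlam
  have hlaml : l1 ≤ lam := (le_max_right _ _).trans hlam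
  have hlamp : 0 < lam := by linarith
  obtain ⟨hAM, hBM, k, k', hk, hkc, hid⟩ := hkey v0 (by linarith) hne A B hA hB
  have hIcc : ∀ v ∈ Icc v1 v0, |v - 1| < R / 2 ∧ 0 < v := by
    intro v hv
    have h1 := hv.1
    have h2 := hv.2
    rw [hv1] at h1
    refine ⟨abs_lt.2 ⟨by linarith, by linarith⟩, by linarith⟩
  have h10 : v1 < v0 := by rw [hv1]; linarith
  have hv1p : 0 < v1 := by rw [hv1]; linarith
  have hmFpos : ∀ v, 0 < v → 0 < mF ε v := by
    intro v hv
    unfold mF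
    have h0 : 0 < ε - 1 := by linarith
    positivity
  have hmFc : ContinuousOn (fun v => (v - 1) * mF ε v) (Icc v1 v0) := by
    unfold mF
    apply ContinuousOn.mul (by fun_prop)
    apply ContinuousOn.div (by fun_prop) (by fun_prop)
    intro v hv
    have := (hIcc v hv).2
    have h0 : 0 < ε - 1 := by linarith
    positivity
  obtain ⟨hw01, hloc⟩ := local_est b M lam v1 v0 hb hM hlamp h10 (by rw [hv1]; linarith) w
    (fun v => mF ε v / rr v) (phiF ε) (fun v => (v - 1) * mF ε v) k k' (FF a b c ε) A B
    (fun v hv => by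
      have := (hrr v (by linarith [(hIcc v hv).1])).2.2
      exact this)
    (fun v hv => div_pos (hmFpos v (hIcc v hv).2) (hrr v (by linarith [(hIcc v hv).1])).1)
    (fun v hv => phiF_deriv ε v hε (hIcc v hv).2) hmFc
    (fun v hv => (hrr v (by linarith [(hIcc v hv).1])).2.1)
    (fun v hv => hk v (hIcc v hv).1)
    (hkc.mono (fun v hv => (hIcc v hv).1))
    (fun v hv => (FF_cont a b c ε v hε (hIcc v hv).2).continuousWithinAt)
    (fun v hv => (hid v (hIcc v (Ioo_subset_Icc_self hv)).1 hv.2).2.1)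
    (fun v hv => (hid v (hIcc v (Ioo_subset_Icc_self hv)).1 hv.2).2.2)
  obtain ⟨it1, ht1⟩ := htail1 v0 lam (by rw [hv1]; linarith) (by linarith) hlaml
  obtain ⟨i0, i1, ht20, ht21⟩ := htail2 (w v0) lam (w v1) (by linarith) hlam1 hw1 hw01
  have hlo := hlow (w v0) lam hs1.le hlamp i0
  have hcomb := J_comb b (w v0) lam (by linarith [(abs_lt.1 hs2).1]) i0 i1
  obtain ⟨J0, hJ0⟩ : ∃ J, J = ∫ y in Ioi (w v0), (y - w v0) ^ (b - 1) * exp (-lam * y ^ 2 / 2) := ⟨_, rfl⟩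
  obtain ⟨J1, hJ1⟩ : ∃ J, J = ∫ y in Ioi (w v0), (y - w v0) ^ (b - 1) * y * exp (-lam * y ^ 2 / 2) := ⟨_, rfl⟩
  have split : ∀ f : ℝ → ℝ, IntegrableOn f (Ioi (w v0)) → (∫ y in Ioi (w v0), f y) =
      (∫ y in Ioo (w v0) (w v1), f y) + ∫ y in Ioi (w v1), f y := by
    intro f hf
    rw [← integral_Ioc_eq_integral_Ioo, ← Ioc_union_Ioi_eq_Ioi hw01.le]
    apply setIntegral_union (by
      rw [Set.disjoint_left]; intro y hy hy'
      exact absurd hy.2 (not_le.2 hy')) measurableSet_Ioi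
    · exact hf.mono_set Ioc_subset_Ioi_self
    · exact hf.mono_set (Ioi_subset_Ioi hw01.le)
  have s0 := split _ i0
  have s1 := split _ i1
  have hle0 : (∫ y in Ioo (w v0) (w v1), (y - w v0) ^ (b - 1) * exp (-lam * y ^ 2 / 2)) ≤ J0 := by
    rw [hJ0]
    apply setIntegral_mono_set i0 _ (Ioo_subset_Ioi_self).eventuallyLE
    refine (ae_restrict_iff' measurableSet_Ioi).2 (ae_of_all _ ?_)
    intro y hy
    have : 0 < y - w v0 := sub_pos.2 hy
    simp only [Pi.zero_apply]
    positivity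
  have iloc : IntegrableOn (fun v => (v0 - v) ^ (b - 1) * FF a b c ε v * exp (-lam * phiF ε v)) (Ioo v1 v0) := by
    apply int_mul_cont _ _ _ _ (int_mul_cont _ _ _ _ (rpow_int_right b _ _ hb h10) _)
    · exact fun v hv => (continuousAt_const.mul (phiF_deriv ε v hε (hIcc v hv).2).continuousAt).rexp.continuousWithinAt
    · exact fun v hv => (FF_cont a b c ε v hε (hIcc v hv).2).continuousWithinAt
  have sv : (∫ v in Ioo 0 v0, (v0 - v) ^ (b - 1) * FF a b c ε v * exp (-lam * phiF ε v)) =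
      (∫ v in Ioc 0 v1, (v0 - v) ^ (b - 1) * FF a b c ε v * exp (-lam * phiF ε v)) +
      ∫ v in Ioo v1 v0, (v0 - v) ^ (b - 1) * FF a b c ε v * exp (-lam * phiF ε v) := by
    rw [← Ioc_union_Ioo_eq_Ioo hv1p.le h10]
    apply setIntegral_union (by
      rw [Set.disjoint_left]; intro y hy hy'
      exact absurd hy.2 (not_le.2 hy'.1)) measurableSet_Ioo it1 iloc
  rw [sv, ← hJ0, ← hJ1]
  rw [← hJ0, ← hJ1] at hcomb
  rw [← hJ0] at s0 hlo
  rw [← hJ1] at s1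
  have hlo' : c0 * exp (-lam * (μ / 4)) ≤ J0 := by
    rw [hμd]; convert hlo using 3; ring
  have a1 := exp_absorb μ l1 lam c0 J0 hμp hlamp hc0 hlo'
  have a2 := exp_absorb μ 0 lam c0 J0 hμp hlamp hc0 hlo'
  have a3 := exp_absorb μ 1 lam c0 J0 hμp hlamp hc0 hlo'
  have hDl : ∀ l, exp (l * μ) * (4 / (3 * μ * c0)) = D l := fun l => by rw [hD]
  rw [hDl] at a1 a2 a3
  rw [hμ, ← hμd] at ht1 hloc
  rw [← hμd] at ht20 ht21
  obtain ⟨T1, hT1⟩ : ∃ T, T = ∫ v in Ioc 0 v1, (v0 - v) ^ (b - 1) * FF a b c ε v * exp (-lam * phiF ε v) := ⟨_, rfl⟩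
  obtain ⟨T2, hT2⟩ : ∃ T, T = ∫ v in Ioo v1 v0, (v0 - v) ^ (b - 1) * FF a b c ε v * exp (-lam * phiF ε v) := ⟨_, rfl⟩
  obtain ⟨L0, hL0⟩ : ∃ T, T = ∫ y in Ioo (w v0) (w v1), (y - w v0) ^ (b - 1) * exp (-lam * y ^ 2 / 2) := ⟨_, rfl⟩
  obtain ⟨L1, hL1⟩ : ∃ T, T = ∫ y in Ioo (w v0) (w v1), (y - w v0) ^ (b - 1) * y * exp (-lam * y ^ 2 / 2) := ⟨_, rfl⟩
  obtain ⟨U0, hU0⟩ : ∃ T, T = ∫ y in Ioi (w v1), (y - w v0) ^ (b - 1) * exp (-lam * y ^ 2 / 2) := ⟨_, rfl⟩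
  obtain ⟨U1, hU1⟩ : ∃ T, T = ∫ y in Ioi (w v1), (y - w v0) ^ (b - 1) * y * exp (-lam * y ^ 2 / 2) := ⟨_, rfl⟩
  rw [← hT1] at ht1
  rw [← hT1, ← hT2]
  rw [← hT2, ← hL0, ← hL1] at hloc
  rw [← hL0, ← hU0] at s0
  rw [← hL1, ← hU1] at s1
  rw [← hU0] at ht20
  rw [← hU1] at ht21
  rw [← hL0] at hle0
  have b1 : |T1| ≤ C1 * (D l1 / lam * J0) := ht1.trans (by gcongr)
  have b2 : M / lam * exp (-lam * μ) ≤ M * (D 0 / lam * J0) := by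
    have e : exp (-lam * μ) ≤ D 0 / lam * J0 := by simpa using a2
    have : M / lam ≤ M := div_le_self hM.le hlam1
    gcongr
  have b3 : (b + 1) * M * M / lam * L0 ≤ (b + 1) * M * M / lam * J0 := by gcongr
  have b4 : |A * U0| ≤ M * (C2 * (D 1 / lam * J0)) := by
    rw [abs_mul]
    gcongr
    exact ht20.trans (by gcongr)
  have b5 : |B * U1| ≤ M * (C2 * (D 1 / lam * J0)) := by
    rw [abs_mul]
    gcongr
    exact ht21.trans (by gcongr)
  have htri : |T1 + T2 - (A * J0 + B * J1)| ≤ |T1| + |T2 - (A * L0 + B * L1)| + |A * U0| + |B * U1| := by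
    rw [s0, s1]
    have e : T1 + T2 - (A * (L0 + U0) + B * (L1 + U1)) = T1 + (T2 - (A * L0 + B * L1)) + -(A * U0) + -(B * U1) := by ring
    rw [e]
    refine (abs_add_le _ _).trans ?_
    rw [abs_neg]
    gcongr
    refine (abs_add_le _ _).trans ?_
    rw [abs_neg]
    gcongr
    exact abs_add_le _ _
  calc |T1 + T2 - (A * J0 + B * J1)| ≤ CC / lam * J0 := by
        have : CC / lam * J0 = C1 * (D l1 / lam * J0) + M * (D 0 / lam * J0) + (b + 1) * M * M / lam * J0 +
          2 * (M * (C2 * (D 1 / lam * J0))) := by rw [hCC]; ring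
        rw [this]; linarith
    _ ≤ CC / lam * (2 * (J0 + J1)) := by gcongr
    _ = _ := by ring

lemma subst_int (a b c ε v0 x lam : ℝ) (hε : 1 < ε) (hv0 : 0 < v0) (hx : x = v0 / (ε - 1 + v0)) :
    (∫ t in Ioo (0:ℝ) 1, t ^ (b - 1) * (1 - t) ^ (c + lam - b - 1) * (1 - x * t) ^ (-(a + ε * lam))) =
    exp (lam * phiF ε v0) * (v0 ^ (1 - c) * (ε - 1 + v0) ^ a) *
      ∫ v in Ioo 0 v0, (v0 - v) ^ (b - 1) * FF a b c ε v * exp (-lam * phiF ε v) := by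
  have hκ : 0 < ε - 1 := by linarith
  have hκv : 0 < ε - 1 + v0 := by linarith
  have himg : (fun t : ℝ => v0 * (1 - t)) '' Ioo 0 1 = Ioo 0 v0 := by
    ext v
    simp only [mem_image, mem_Ioo]
    constructor
    · rintro ⟨t, ⟨h1, h2⟩, rfl⟩
      constructor <;> nlinarith
    · rintro ⟨h1, h2⟩
      refine ⟨1 - v / v0, ⟨?_, ?_⟩, ?_⟩
      · rw [sub_pos, div_lt_one hv0]; exact h2
      · have : 0 < v / v0 := by positivity
        linarith
      · field_simp; ring
  have hder : ∀ t ∈ Ioo (0:ℝ) 1, HasDerivWithinAt (fun t : ℝ => v0 * (1 - t)) (-v0) (Ioo 0 1) t := by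
    intro t _
    have := (((hasDerivAt_id t).const_sub 1).const_mul v0).hasDerivWithinAt (s := Ioo (0:ℝ) 1)
    simpa using this
  have hinj : InjOn (fun t : ℝ => v0 * (1 - t)) (Ioo 0 1) := by
    intro t _ s _ h
    have := mul_left_cancel₀ hv0.ne' h
    linarith
  rw [← himg, integral_image_eq_integral_abs_deriv_smul measurableSet_Ioo hder hinj, ← integral_const_mul]
  apply setIntegral_congr_fun measurableSet_Ioo
  intro t ht
  have ht0 := ht.1
  have ht1 : 0 < 1 - t := by linarith [ht.2]
  have hx1 : x < 1 := by rw [hx, div_lt_one hκv]; linarith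
  have hx0 : 0 < x := by rw [hx]; positivity
  have hxt : 0 < 1 - x * t := by nlinarith [ht.2]
  have e1 : v0 - v0 * (1 - t) = v0 * t := by ring
  have e2 : ε - 1 + v0 * (1 - t) = (ε - 1 + v0) * (1 - x * t) := by rw [hx]; field_simp; ring
  simp only [smul_eq_mul, abs_neg, abs_of_pos hv0]
  unfold FF phiF
  rw [e1, e2]
  rw [Real.log_mul hv0.ne' ht1.ne', Real.log_div (by positivity) (by positivity),
    Real.log_div (by positivity) (by positivity), Real.log_mul hκv.ne' hxt.ne']
  rw [mul_rpow hv0.le ht0.le, mul_rpow hv0.le ht1.le, mul_rpow hκv.le hxt.le]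
  have e3 : v0 = exp (Real.log v0) := (exp_log hv0).symm
  simp only [rpow_def_of_pos hv0, rpow_def_of_pos ht0, rpow_def_of_pos ht1, rpow_def_of_pos hκv,
    rpow_def_of_pos hxt]
  have e4 : ∀ y : ℝ, v0 * y = exp (Real.log v0) * y := fun y => by rw [exp_log hv0]
  rw [e4]
  simp only [← exp_add]
  congr 1
  ring

lemma coeffs (a b c ε v0 x r0 r1 : ℝ) (hε : 1 < ε) (hv0 : 0 < v0) (hne : v0 ≠ 1)
    (hx : x = v0 / (ε - 1 + v0)) (hr0 : 0 < r0) (hr1 : 0 < r1) (hr1s : r1 ^ 2 = (ε - 1) / ε)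
    (hr0s : ((1 - v0) * r0) ^ 2 = 2 * phiF ε v0) :
    psi ε x (tsad ε x) = -phiF ε v0 ∧ alph ε x = -((1 - v0) * r0) ∧
    A0 a b c ε x = (v0 ^ (1 - c) * (ε - 1 + v0) ^ a) * (FF a b c ε 1 * r0 ^ (1 - b) / r1) ∧
    B0 a b c ε x = (v0 ^ (1 - c) * (ε - 1 + v0) ^ a) * ((FF a b c ε 1 * r0 ^ (1 - b) / r1 -
      FF a b c ε v0 * (r0 / mF ε v0) ^ b) / (-((1 - v0) * r0))) := by
  have hκ : 0 < ε - 1 := by linarith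
  have hε0 : 0 < ε := by linarith
  have hκv : 0 < ε - 1 + v0 := by linarith
  have hne' : v0 - 1 ≠ 0 := sub_ne_zero.2 hne
  have hts : tsad ε x = 1 - 1 / v0 := by
    unfold tsad; rw [hx]; field_simp; ring
  have h1ts : 1 - tsad ε x = 1 / v0 := by rw [hts]; ring
  have h1x : 1 - x * tsad ε x = ε / (ε - 1 + v0) := by rw [hts, hx]; field_simp; ring
  have hex : ε * x - 1 = (ε - 1) * (v0 - 1) / (ε - 1 + v0) := by rw [hx]; field_simp; ring
  have hpsi : psi ε x (tsad ε x) = -phiF ε v0 := by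
    unfold psi phiF
    rw [h1ts, h1x, Real.log_div hε0.ne' hκv.ne', Real.log_div hκv.ne' hε0.ne', one_div, Real.log_inv]
    ring
  have hal : alph ε x = -((1 - v0) * r0) := by
    unfold alph
    rw [hpsi, show -2 * -phiF ε v0 = ((1 - v0) * r0) ^ 2 by rw [hr0s]; ring, Real.sqrt_sq_eq_abs, abs_mul,
      abs_of_pos hr0, hex]
    rcases lt_or_gt_of_ne hne with h | h
    · have : (ε - 1) * (v0 - 1) / (ε - 1 + v0) < 0 := by
        apply div_neg_of_neg_of_pos _ hκv
        nlinarith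
      rw [Real.sign_of_neg this, abs_of_pos (by linarith)]; ring
    · have : 0 < (ε - 1) * (v0 - 1) / (ε - 1 + v0) := by
        apply div_pos _ hκv
        nlinarith
      rw [Real.sign_of_pos this, abs_of_neg (by linarith)]; ring
  have hA : A0 a b c ε x = (v0 ^ (1 - c) * (ε - 1 + v0) ^ a) * (FF a b c ε 1 * r0 ^ (1 - b) / r1) := by
    unfold A0 famp psi2 FF
    rw [h1ts, h1x, hal, hts]
    have e1 : (1 - 1 / v0) / -((1 - v0) * r0) = (v0 * r0)⁻¹ := by
      have : 1 - v0 ≠ 0 := fun h => hne' (by linarith)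
      field_simp
      ring
    have e2 : -ε * x ^ 2 / (ε / (ε - 1 + v0)) ^ 2 + 1 / (1 / v0) ^ 2 = (v0 * r1) ^ 2 := by
      rw [mul_pow, hr1s, hx]; field_simp; ring
    have e3 : ((v0 * r1) ^ 2) ^ (-(1:ℝ) / 2) = (v0 * r1)⁻¹ := by
      rw [← rpow_natCast, ← rpow_mul (by positivity)]
      rw [show ((2:ℕ):ℝ) * (-1 / 2) = -1 by norm_num, rpow_neg_one]
    rw [e1, e2, e3, one_div, inv_rpow hv0.le, inv_rpow (by positivity), mul_rpow hv0.le hr0.le,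
      div_rpow hε0.le hκv.le, one_rpow, show ε - 1 + 1 = ε by ring, rpow_neg hκv.le,
      show (1 - b) = -(b - 1) by ring, rpow_neg hr0.le]
    have e4 : v0 ^ (1 - c) = (v0 ^ (c - b - 1))⁻¹ * (v0 ^ (b - 1))⁻¹ * v0⁻¹ := by
      rw [← rpow_neg hv0.le, ← rpow_neg hv0.le, ← rpow_neg_one, ← rpow_add hv0, ← rpow_add hv0]
      congr 1; ring
    rw [e4]
    field_simp
  refine ⟨hpsi, hal, hA, ?_⟩
  unfold B0
  have hB : (alph ε x / (ε * x - 1)) ^ b =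
      (v0 ^ (1 - c) * (ε - 1 + v0) ^ a) * (FF a b c ε v0 * (r0 / mF ε v0) ^ b) := by
    have e1 : alph ε x / (ε * x - 1) = r0 * (ε - 1 + v0) / (ε - 1) := by
      rw [hal, hex]; field_simp; ring
    have e2 : r0 / mF ε v0 = v0 * (r0 * (ε - 1 + v0) / (ε - 1)) := by
      unfold mF; field_simp
    rw [e1, e2, mul_rpow hv0.le (by positivity)]
    unfold FF
    have e3 : v0 ^ (1 - c) * v0 ^ (c - b - 1) * v0 ^ b = 1 := by
      rw [← rpow_add hv0, ← rpow_add hv0]; rw [show 1 - c + (c - b - 1) + b = 0 by ring, rpow_zero]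
    have e4 : (ε - 1 + v0) ^ a * (ε - 1 + v0) ^ (-a) = 1 := by
      rw [← rpow_add hκv]; simp
    set Z := (r0 * (ε - 1 + v0) / (ε - 1)) ^ b
    linear_combination (-Z * (ε - 1 + v0) ^ a * (ε - 1 + v0) ^ (-a)) * e3 - Z * e4
  rw [hB, hA, hal]
  ring

/-- The leading-order, uniform-in-`x` form of the Bleistein expansion (Theorem 1): for
`ε > 1`, `b > 0`, there are `δ₀ ∈ (0, 1 - 1/ε)`, `C > 0`, `λ₀ > 0` such that for all `x` with
`0 < |x - 1/ε| ≤ δ₀` and all `λ ≥ λ₀`,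
`|₂F₁(a+ελ, b; c+λ; x) - G(λ) e^{-λψ(x,t_s)} (λ^{-b/2} S₀(αλ^{1/2}) A₀ +
  λ^{-(b+1)/2} S₁(αλ^{1/2}) B₀)|
  ≤ C λ⁻¹ G(λ) e^{-λψ(x,t_s)} (λ^{-b/2} S₀(αλ^{1/2}) + λ^{-(b+1)/2} S₁(αλ^{1/2}))`. -/
theorem bleistein_uniform_leading (a b c ε : ℝ) (hb : 0 < b) (hε : 1 < ε) :
    ∃ δ₀ : ℝ, 0 < δ₀ ∧ δ₀ < 1 - 1 / ε ∧ ∃ C > (0 : ℝ), ∃ lam₀ > (0 : ℝ),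
      ∀ x : ℝ, 0 < x → x < 1 → 0 < |x - 1 / ε| → |x - 1 / ε| ≤ δ₀ →
        ∀ lam : ℝ, lam₀ ≤ lam →
          |hyp2F1 (a + ε * lam) b (c + lam) x
              - Grat b c lam * Real.exp (-lam * psi ε x (tsad ε x)) *
                  (lam ^ (-b / 2) * S b 0 (alph ε x * Real.sqrt lam) * A0 a b c ε x
                    + lam ^ (-(b + 1) / 2) * S b 1 (alph ε x * Real.sqrt lam) * B0 a b c ε x)|
            ≤ C * lam⁻¹ * Grat b c lam * Real.exp (-lam * psi ε x (tsad ε x)) *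
                (lam ^ (-b / 2) * S b 0 (alph ε x * Real.sqrt lam)
                  + lam ^ (-(b + 1) / 2) * S b 1 (alph ε x * Real.sqrt lam)) := by
  obtain ⟨η, hη, hη2, rr, C, hC, l0, hl0, hr1p, hr1s, hmain⟩ := main_v a b c ε hb hε
  have hκ : 0 < ε - 1 := by linarith
  have hε0 : 0 < ε := by linarith
  have h1e : 0 < 1 - 1 / ε := by rw [sub_pos, div_lt_one hε0]; exact hε
  have hev : ∀ᶠ x in 𝓝 (1 / ε), |(ε - 1) * x / (1 - x) - 1| < η := by
    have hc : ContinuousAt (fun x : ℝ => |(ε - 1) * x / (1 - x) - 1|) (1 / ε) := by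
      have : ContinuousAt (fun x : ℝ => (ε - 1) * x / (1 - x)) (1 / ε) :=
        ContinuousAt.div (by fun_prop) (by fun_prop) h1e.ne'
      exact (this.sub continuousAt_const).abs
    apply hc.eventually_lt_const
    have : (ε - 1) * (1 / ε) / (1 - 1 / ε) - 1 = 0 := by field_simp; ring
    simp only [this, abs_zero]; exact hη
  obtain ⟨δ', hδ', hball⟩ := Metric.eventually_nhds_iff.1 hev
  obtain ⟨Km, hKm⟩ : ∃ Km : ℝ, Km = ((1 / 2) ^ (1 - c) + (3 / 2) ^ (1 - c)) *
    ((ε - 1) ^ a + (ε - 1 + 3 / 2) ^ a) := ⟨_, rfl⟩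
  have hKmp : 0 < Km := by rw [hKm]; positivity
  refine ⟨min (δ' / 2) ((1 - 1 / ε) / 2), by positivity, (min_le_right _ _).trans_lt (by linarith),
    Km * C, by positivity, max l0 (|a| + |c| + b + 1), lt_of_lt_of_le one_pos (hl0.trans (le_max_left _ _)), ?_⟩
  intro x hx0 hx1 hxne hxd lam hlam
  have hlaml : l0 ≤ lam := (le_max_left _ _).trans hlam
  have hlam2 : |a| + |c| + b + 1 ≤ lam := (le_max_right _ _).trans hlam
  have hlamp : 0 < lam := by linarith
  have ha := neg_abs_le a
  have hc := neg_abs_le c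
  have ha0 := abs_nonneg a
  have hc0 := abs_nonneg c
  have h1x : 0 < 1 - x := by linarith
  obtain ⟨v0, hv0d⟩ : ∃ v0, v0 = (ε - 1) * x / (1 - x) := ⟨_, rfl⟩
  have hv0 : 0 < v0 := by rw [hv0d]; positivity
  have hv0η : |v0 - 1| ≤ η := by
    rw [hv0d]
    apply le_of_lt
    apply hball
    rw [Real.dist_eq]
    have := hxd.trans (min_le_left _ _)
    linarith
  have hxv : x = v0 / (ε - 1 + v0) := by rw [hv0d]; field_simp; ring
  have hne : v0 ≠ 1 := by
    intro h
    rw [h] at hxv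
    have : x - 1 / ε = 0 := by rw [hxv]; rw [show ε - 1 + 1 = ε by ring]; ring
    rw [this, abs_zero] at hxne
    exact lt_irrefl _ hxne
  obtain ⟨hr0p, hr0s, hest⟩ := hmain v0 hv0η hne
  obtain ⟨hpsi, hal, hA, hB⟩ := coeffs a b c ε v0 x (rr v0) (rr 1) hε hv0 hne hxv hr0p hr1p hr1s hr0s
  have hest' := hest _ _ rfl rfl _ rfl lam hlaml
  obtain ⟨A, hAd⟩ : ∃ A, A = FF a b c ε 1 * rr v0 ^ (1 - b) / rr 1 := ⟨_, rfl⟩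
  rw [← hAd] at hest' hA hB
  obtain ⟨B, hBd⟩ : ∃ B, B = (A - FF a b c ε v0 * (rr v0 / mF ε v0) ^ b) / (-((1 - v0) * rr v0)) := ⟨_, rfl⟩
  rw [← hBd] at hest' hB
  obtain ⟨w0, hw0⟩ : ∃ w0, w0 = (1 - v0) * rr v0 := ⟨_, rfl⟩
  rw [← hw0] at hest' hal
  obtain ⟨K, hK⟩ : ∃ K, K = v0 ^ (1 - c) * (ε - 1 + v0) ^ a := ⟨_, rfl⟩
  rw [← hK] at hA hB
  have hKp : 0 < K := by rw [hK]; positivity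
  have hKle : K ≤ Km := by
    have hh := abs_le.1 hv0η
    rw [hK, hKm]
    apply mul_le_mul
    · exact rpow_le_add_of_mem _ (by norm_num) (by linarith) (by linarith)
    · exact rpow_le_add_of_mem _ hκ (by linarith) (by linarith)
    · positivity
    · positivity
  have hEul := euler_int (a + ε * lam) b (c + lam) x (by nlinarith) hb (by linarith) hx0 hx1
  rw [subst_int a b c ε v0 x lam hε hv0 hxv, ← hK] at hEul
  have hS0 := S_scale b lam w0 0 hlamp
  have hS1 := S_scale b lam w0 1 hlamp
  simp only [pow_zero, pow_one, mul_one, Nat.cast_zero, Nat.cast_one, add_zero] at hS0 hS1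
  have hG : 0 < Grat b c lam := by
    unfold Grat
    exact div_pos (Gamma_pos_of_pos (by linarith)) (Gamma_pos_of_pos (by linarith))
  have hGb : 0 < 1 / Gamma b := one_div_pos.2 (Gamma_pos_of_pos hb)
  rw [hEul, hpsi, hal, hS0, hS1, hA, hB]
  rw [show Gamma (c + lam) / Gamma (c + lam - b) = Grat b c lam from rfl]
  rw [show -lam * -phiF ε v0 = lam * phiF ε v0 by ring]
  obtain ⟨J0, hJ0⟩ : ∃ J, J = ∫ y in Ioi w0, (y - w0) ^ (b - 1) * exp (-lam * y ^ 2 / 2) := ⟨_, rfl⟩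
  obtain ⟨J1, hJ1⟩ : ∃ J, J = ∫ y in Ioi w0, (y - w0) ^ (b - 1) * y * exp (-lam * y ^ 2 / 2) := ⟨_, rfl⟩
  obtain ⟨I, hI⟩ : ∃ J, J = ∫ v in Ioo 0 v0, (v0 - v) ^ (b - 1) * FF a b c ε v * exp (-lam * phiF ε v) := ⟨_, rfl⟩
  rw [← hJ0, ← hJ1, ← hI] at hest' ⊢
  have hJn : 0 ≤ J0 + J1 := by
    have h1 : 0 < C / lam := by positivity
    have h2 := (abs_nonneg _).trans hest'
    exact nonneg_of_mul_nonneg_right h2 h1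
  obtain ⟨Q, hQ⟩ : ∃ Q, Q = Grat b c lam * (1 / Gamma b) * exp (lam * phiF ε v0) := ⟨_, rfl⟩
  have hQp : 0 < Q := by rw [hQ]; positivity
  have e1 : Grat b c lam * (1 / Gamma b) * (exp (lam * phiF ε v0) * K * I) -
      Grat b c lam * exp (lam * phiF ε v0) * (1 / Gamma b * J0 * (K * A) + 1 / Gamma b * J1 * (K * B)) =
      Q * K * (I - (A * J0 + B * J1)) := by rw [hQ]; ring
  have e2 : Km * C * lam⁻¹ * Grat b c lam * exp (lam * phiF ε v0) * (1 / Gamma b * J0 + 1 / Gamma b * J1) =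
      Q * Km * (C / lam * (J0 + J1)) := by rw [hQ]; ring
  rw [e1, e2, abs_mul, abs_of_pos (mul_pos hQp hKp)]
  gcongr
end

section
/- Let b>0 and let k≥0 be an integer. If k is even, then lim_{χ→+∞} S_k(χ)/χ^{b−1} = 2^{(k+1)/2}·Γ((k+1)/2)/Γ(b). If k is odd and b≠1, then lim_{χ→+∞} S_k(χ)/χ^{b−2} = 2^{k/2+1}·Γ(k/2+1)/Γ(b−1). -/
open MeasureTheory Real Filter Topology

/-- The Gaussian weight. -/
noncomputable def gw (k : ℕ) (u : ℝ) : ℝ := u ^ k * Real.exp (-u ^ 2 / 2)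

/-- The rescaled, truncated amplitude. -/
noncomputable def ph (a χ u : ℝ) : ℝ :=
  χ * ((Set.Ioi (-χ / 2)).indicator (fun u => (1 + u / χ) ^ a) u - 1)

lemma gw_integrable (k : ℕ) : Integrable (gw k) := by
  have h := integrable_rpow_mul_exp_neg_mul_sq (b := 1 / 2) (by norm_num) (s := (k : ℝ))
    (by have : (0 : ℝ) ≤ k := Nat.cast_nonneg k
        linarith)
  refine h.congr (ae_of_all _ fun u => ?_)
  simp only [gw, Real.rpow_natCast]
  congr 2
  ring

lemma gw_odd (k : ℕ) (hk : Odd k) : ∫ u, gw k u = 0 := by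
  have h := integral_neg_eq_self (gw k) volume
  have h2 : ∀ u, gw k (-u) = - gw k u := fun u => by
    simp [gw, hk.neg_pow]
  simp only [h2, integral_neg] at h
  linarith

lemma gw_even (k : ℕ) (hk : Even k) :
    ∫ u, gw k u = 2 ^ (((k : ℝ) + 1) / 2) * Real.Gamma (((k : ℝ) + 1) / 2) := by
  have h1 : ∀ u, gw k u = gw k |u| := fun u => by
    simp [gw, hk.pow_abs]
  have h2 : ∫ u, gw k u = 2 * ∫ u in Set.Ioi 0, gw k u := by
    rw [← integral_comp_abs]
    exact integral_congr_ae (ae_of_all _ h1)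
  have hk0 : (0 : ℝ) ≤ k := Nat.cast_nonneg k
  have h3 := integral_rpow_mul_exp_neg_mul_rpow (p := 2) (q := k) (b := 1 / 2)
    (by norm_num) (by linarith) (by norm_num)
  have h4 : ∫ u in Set.Ioi 0, gw k u =
      ∫ x in Set.Ioi (0 : ℝ), x ^ (k : ℝ) * rexp (-(1 / 2) * x ^ (2 : ℝ)) := by
    refine integral_congr_ae (ae_of_all _ fun u => ?_)
    simp only [gw, Real.rpow_natCast, Real.rpow_two]
    congr 2
    ring
  rw [h2, h4, h3, one_div, Real.inv_rpow (by norm_num), neg_div, Real.rpow_neg (by norm_num)]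
  rw [inv_inv]
  ring

lemma rpow_bd (a : ℝ) (n : ℕ) (hn : |a| + 1 ≤ n) (R ξ : ℝ) (hR : 1 ≤ R) (h1 : 1 / 2 ≤ ξ)
    (h2 : ξ ≤ R) : ξ ^ (a - 1) ≤ (2 * R) ^ n := by
  have hξ : 0 < ξ := by linarith
  have ha := abs_le.1 (le_refl |a|)
  rcases le_total 1 ξ with h | h
  · calc ξ ^ (a - 1) ≤ ξ ^ (n : ℝ) := Real.rpow_le_rpow_of_exponent_le h (by linarith)
      _ = ξ ^ n := Real.rpow_natCast _ _
      _ ≤ _ := pow_le_pow_left₀ hξ.le (by linarith) _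
  · calc ξ ^ (a - 1) ≤ ξ ^ (-(n : ℝ)) :=
          Real.rpow_le_rpow_of_exponent_ge hξ h (by linarith)
      _ = (ξ⁻¹) ^ n := by rw [Real.rpow_neg hξ.le, Real.rpow_natCast, inv_pow]
      _ ≤ _ := by
        apply pow_le_pow_left₀ (by positivity)
        have : ξ⁻¹ ≤ 2 := by
          rw [inv_le_comm₀ hξ (by norm_num)]; linarith
        linarith

lemma ph_bd (a : ℝ) (n : ℕ) (hn : |a| + 1 ≤ n) (χ u : ℝ) (hχ : 1 ≤ χ) :
    |ph a χ u| ≤ (|a| + 2) * ((2 * (1 + |u|)) ^ n * |u|) := by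
  have hχ0 : 0 < χ := by linarith
  have hu := abs_nonneg u
  have ha := abs_nonneg a
  have hpow : 1 ≤ (2 * (1 + |u|)) ^ n := one_le_pow₀ (by linarith)
  unfold ph
  by_cases h : u ∈ Set.Ioi (-χ / 2)
  · rw [Set.indicator_of_mem h]
    have hu' : -χ / 2 < u := h
    have hx1 : 1 / 2 ≤ 1 + u / χ := by
      have : -(1 / 2) ≤ u / χ := by rw [le_div_iff₀ hχ0]; linarith
      linarith
    have hx2 : 1 + u / χ ≤ 1 + |u| := by
      have : u / χ ≤ |u| := by
        rw [div_le_iff₀ hχ0]; nlinarith [le_abs_self u]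
      linarith
    have hmv := Convex.norm_image_sub_le_of_norm_hasDerivWithin_le (𝕜 := ℝ)
      (f := fun x : ℝ => x ^ a) (f' := fun x => a * x ^ (a - 1)) (s := Set.Icc (1 / 2) (1 + |u|))
      (x := 1) (y := 1 + u / χ) (C := |a| * (2 * (1 + |u|)) ^ n)
      (fun x hx => (Real.hasDerivAt_rpow_const
        (Or.inl (by have := hx.1; intro h0; rw [h0] at this; norm_num at this))).hasDerivWithinAt)
      (fun x hx => by
        have h0 : 0 ≤ x := le_trans (by norm_num) hx.1
        rw [norm_mul, Real.norm_eq_abs, Real.norm_eq_abs, abs_of_nonneg (Real.rpow_nonneg h0 _)]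
        exact mul_le_mul_of_nonneg_left (rpow_bd a n hn _ x (by linarith) hx.1 hx.2) ha)
      (convex_Icc _ _) ⟨by norm_num, by linarith⟩ ⟨hx1, hx2⟩
    simp only [Real.one_rpow, Real.norm_eq_abs, add_sub_cancel_left] at hmv
    rw [abs_mul, abs_of_pos hχ0]
    calc χ * |(1 + u / χ) ^ a - 1| ≤ χ * (|a| * (2 * (1 + |u|)) ^ n * |u / χ|) :=
          mul_le_mul_of_nonneg_left hmv hχ0.le
      _ = |a| * ((2 * (1 + |u|)) ^ n * |u|) := by
          rw [abs_div, abs_of_pos hχ0]; field_simp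
      _ ≤ _ := by
          apply mul_le_mul_of_nonneg_right (by linarith) (by positivity)
  · rw [Set.indicator_of_notMem h]
    have hu' : u ≤ -χ / 2 := not_lt.1 h
    have : χ ≤ 2 * |u| := by linarith [neg_abs_le u]
    rw [zero_sub, mul_neg, mul_one, abs_neg, abs_of_pos hχ0]
    calc χ ≤ 2 * (1 * |u|) := by linarith
      _ ≤ _ := by gcongr <;> linarith

lemma ph_tendsto (a u : ℝ) : Tendsto (fun χ => ph a χ u) atTop (𝓝 (a * u)) := by
  have hd : HasDerivAt (fun t : ℝ => (1 + u * t) ^ a) (a * u) 0 := by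
    have h1 : HasDerivAt (fun t : ℝ => 1 + u * t) u 0 := by
      simpa using ((hasDerivAt_id (0 : ℝ)).const_mul u).const_add 1
    have h2 := h1.rpow_const (p := a) (Or.inl (by simp))
    convert h2 using 1
    simp [mul_comm]
  have hs := hd.tendsto_slope
  have hi : Tendsto (fun χ : ℝ => χ⁻¹) atTop (𝓝[≠] 0) :=
    tendsto_inv_atTop_nhdsGT_zero.mono_right (nhdsWithin_mono _ fun x hx => ne_of_gt hx)
  refine (hs.comp hi).congr' ?_
  filter_upwards [eventually_gt_atTop (max 0 (-2 * u))] with χ hχ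
  have h0 : 0 < χ := (le_max_left _ _).trans_lt hχ
  have h1 : -2 * u < χ := (le_max_right _ _).trans_lt hχ
  have hm : u ∈ Set.Ioi (-χ / 2) := by
    show -χ / 2 < u
    linarith
  unfold ph
  rw [Set.indicator_of_mem hm]
  simp [slope_def_field, div_eq_mul_inv, mul_comm]

lemma bd_integrable (c : ℝ) (n k : ℕ) :
    Integrable (fun u => c * ((2 * (1 + |u|)) ^ n * |u|) * |gw k u|) := by
  have h : ∀ u : ℝ, c * ((2 * (1 + |u|)) ^ n * |u|) * |gw k u| =
      ∑ m ∈ Finset.range (n + 1), (c * 2 ^ n * (n.choose m)) * |gw (m + 1 + k) u| := by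
    intro u
    rw [mul_pow, add_comm (1 : ℝ), add_pow]
    simp only [Finset.mul_sum, Finset.sum_mul, gw, abs_mul, abs_pow]
    refine Finset.sum_congr rfl fun m _ => ?_
    ring
  simp only [h]
  exact integrable_finsetSum _ fun m _ => ((gw_integrable _).abs.const_mul _)

lemma ph_meas (a χ : ℝ) (k : ℕ) : AEStronglyMeasurable (fun u => ph a χ u * gw k u) := by
  apply Measurable.aestronglyMeasurable
  unfold ph gw
  refine Measurable.mul (Measurable.const_mul (Measurable.sub_const
    (Measurable.indicator ?_ measurableSet_Ioi) _) _) (by fun_prop)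
  fun_prop

lemma ph_gw_bd (a : ℝ) (k n : ℕ) (hn : |a| + 1 ≤ n) (χ u : ℝ) (hχ : 1 ≤ χ) :
    ‖ph a χ u * gw k u‖ ≤ (|a| + 2) * ((2 * (1 + |u|)) ^ n * |u|) * |gw k u| := by
  rw [norm_mul, Real.norm_eq_abs, Real.norm_eq_abs]
  exact mul_le_mul_of_nonneg_right (ph_bd a n hn χ u hχ) (abs_nonneg _)

lemma ph_gw_integrable (a : ℝ) (k : ℕ) (χ : ℝ) (hχ : 1 ≤ χ) :
    Integrable (fun u => ph a χ u * gw k u) := by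
  obtain ⟨n, hn⟩ := exists_nat_ge (|a| + 1)
  exact (bd_integrable (|a| + 2) n k).mono' (ph_meas a χ k)
    (ae_of_all _ fun u => ph_gw_bd a k n hn χ u hχ)

lemma main_tendsto (a : ℝ) (k : ℕ) :
    Tendsto (fun χ => ∫ u, ph a χ u * gw k u) atTop (𝓝 (a * ∫ u, gw (k + 1) u)) := by
  obtain ⟨n, hn⟩ := exists_nat_ge (|a| + 1)
  have h := tendsto_integral_filter_of_dominated_convergence (μ := volume) (l := atTop)
    (F := fun χ u => ph a χ u * gw k u) (f := fun u => a * u * gw k u)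
    (fun u => (|a| + 2) * ((2 * (1 + |u|)) ^ n * |u|) * |gw k u|)
    (Eventually.of_forall fun χ => ph_meas a χ k)
    (by filter_upwards [eventually_ge_atTop 1] with χ hχ
        exact ae_of_all _ fun u => ph_gw_bd a k n hn χ u hχ)
    (bd_integrable _ n k)
    (ae_of_all _ fun u => (ph_tendsto a u).mul_const _)
  convert h using 2
  rw [← integral_const_mul]
  refine integral_congr_ae (ae_of_all _ fun u => ?_)
  simp only [gw]
  ring

/-- the part of the integral over `τ > χ/2` -/
lemma part2 (a : ℝ) (k : ℕ) (χ : ℝ) (hχ : 1 ≤ χ) :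
    IntegrableOn (fun τ => τ ^ a * gw k (τ - χ)) (Set.Ioi (χ / 2)) ∧
    ∫ τ in Set.Ioi (χ / 2), τ ^ a * gw k (τ - χ) =
      χ ^ a * (χ⁻¹ * (∫ u, ph a χ u * gw k u) + ∫ u, gw k u) := by
  have h0 : 0 < χ := by linarith
  have key : ∀ τ, (Set.Ioi (χ / 2)).indicator (fun τ => τ ^ a * gw k (τ - χ)) τ =
      (fun u => χ ^ a * (χ⁻¹ * (ph a χ u * gw k u) + gw k u)) (τ + -χ) := by
    intro τ
    simp only [← sub_eq_add_neg]
    by_cases h : τ ∈ Set.Ioi (χ / 2)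
    · have h' : χ / 2 < τ := h
      have hm : τ - χ ∈ Set.Ioi (-χ / 2) := by
        show -χ / 2 < τ - χ
        linarith
      rw [Set.indicator_of_mem h]
      simp only [ph]
      rw [Set.indicator_of_mem hm]
      have e : 1 + (τ - χ) / χ = τ / χ := by field_simp; ring
      have hp : χ ^ a ≠ 0 := (Real.rpow_pos_of_pos h0 a).ne'
      rw [e, Real.div_rpow (by linarith) h0.le]
      field_simp
      ring
    · have h' : τ ≤ χ / 2 := not_lt.1 h
      have hm : τ - χ ∉ Set.Ioi (-χ / 2) := by
        show ¬ (-χ / 2 < τ - χ)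
        linarith
      rw [Set.indicator_of_notMem h]
      simp only [ph]
      rw [Set.indicator_of_notMem hm]
      field_simp
      ring
  have hint : Integrable (fun u => χ ^ a * (χ⁻¹ * (ph a χ u * gw k u) + gw k u)) :=
    (((ph_gw_integrable a k χ hχ).const_mul _).add (gw_integrable k)).const_mul _
  constructor
  · rw [← integrable_indicator_iff measurableSet_Ioi]
    exact (hint.comp_add_right (-χ)).congr (ae_of_all _ fun τ => (key τ).symm)
  · rw [← integral_indicator measurableSet_Ioi, integral_congr_ae (ae_of_all _ key),
      integral_add_right_eq_self (fun u => χ ^ a * (χ⁻¹ * (ph a χ u * gw k u) + gw k u)) (-χ),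
      integral_const_mul, integral_add ((ph_gw_integrable a k χ hχ).const_mul _)
      (gw_integrable k), integral_const_mul]

/-- the part of the integral over `τ ≤ χ/2` -/
lemma part1 (a : ℝ) (ha : -1 < a) (k : ℕ) (χ : ℝ) (hχ : 8 ≤ χ) :
    IntegrableOn (fun τ => τ ^ a * gw k (τ - χ)) (Set.Ioc 0 (χ / 2)) ∧
    |∫ τ in Set.Ioc 0 (χ / 2), τ ^ a * gw k (τ - χ)| ≤
      (χ ^ (a + 1) / (a + 1)) * (χ ^ k * rexp (-χ)) := by
  have h0 : 0 < χ := by linarith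
  have hI : IntegrableOn (fun τ : ℝ => τ ^ a) (Set.Ioc 0 (χ / 2)) :=
    (intervalIntegrable_iff_integrableOn_Ioc_of_le (by linarith)).1
      (intervalIntegral.intervalIntegrable_rpow' ha)
  have hI' := hI.mul_const (χ ^ k * rexp (-χ))
  have hb : ∀ᵐ τ ∂(volume.restrict (Set.Ioc 0 (χ / 2))),
      ‖τ ^ a * gw k (τ - χ)‖ ≤ τ ^ a * (χ ^ k * rexp (-χ)) := by
    refine (ae_restrict_mem measurableSet_Ioc).mono fun τ hτ => ?_
    have h1 := hτ.1
    have h2 := hτ.2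
    rw [norm_mul, Real.norm_eq_abs, abs_of_nonneg (Real.rpow_nonneg h1.le _)]
    refine mul_le_mul_of_nonneg_left ?_ (Real.rpow_nonneg h1.le _)
    rw [gw, norm_mul, norm_pow, Real.norm_eq_abs, Real.norm_eq_abs, Real.abs_exp]
    refine mul_le_mul (pow_le_pow_left₀ (abs_nonneg _) ?_ _) (Real.exp_le_exp.2 ?_)
      (Real.exp_nonneg _) (by positivity)
    · rw [abs_le]; constructor <;> linarith
    · nlinarith [mul_nonneg (sub_nonneg.2 h2) (sub_nonneg.2 h2)]
  have hm : AEStronglyMeasurable (fun τ => τ ^ a * gw k (τ - χ))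
      (volume.restrict (Set.Ioc 0 (χ / 2))) := by
    apply Measurable.aestronglyMeasurable
    unfold gw
    fun_prop
  refine ⟨Integrable.mono' hI' hm hb, ?_⟩
  refine (norm_integral_le_of_norm_le hI' hb).trans ?_
  rw [integral_mul_const, ← intervalIntegral.integral_of_le (by linarith),
    integral_rpow (Or.inl ha), Real.zero_rpow (by linarith), sub_zero]
  have : (χ / 2) ^ (a + 1) ≤ χ ^ (a + 1) :=
    Real.rpow_le_rpow (by linarith) (by linarith) (by linarith)
  have ha' : 0 < a + 1 := by linarith
  gcongr

lemma part1_tendsto (a : ℝ) (ha : -1 < a) (k : ℕ) :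
    Tendsto (fun χ => χ * ((∫ τ in Set.Ioc 0 (χ / 2), τ ^ a * gw k (τ - χ)) / χ ^ a))
      atTop (𝓝 0) := by
  have h := (tendsto_pow_mul_exp_neg_atTop_nhds_zero (k + 2)).const_mul (1 / (a + 1))
  rw [mul_zero] at h
  refine squeeze_zero_norm' ?_ h
  filter_upwards [eventually_ge_atTop 8] with χ hχ
  have h0 : 0 < χ := by linarith
  have hp : 0 < χ ^ a := Real.rpow_pos_of_pos h0 a
  have ha' : 0 < a + 1 := by linarith
  rw [norm_mul, norm_div, Real.norm_eq_abs, Real.norm_eq_abs, Real.norm_eq_abs,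
    abs_of_pos h0, abs_of_pos hp]
  calc _ ≤ χ * (((χ ^ (a + 1) / (a + 1)) * (χ ^ k * rexp (-χ))) / χ ^ a) := by
        gcongr
        exact (part1 a ha k χ hχ).2
    _ = _ := by
        rw [Real.rpow_add_one h0.ne']
        field_simp
        try ring

lemma total_tendsto (a : ℝ) (ha : -1 < a) (k : ℕ) :
    Tendsto (fun χ => χ * ((∫ τ in Set.Ioi 0, τ ^ a * gw k (τ - χ)) / χ ^ a - ∫ u, gw k u))
      atTop (𝓝 (a * ∫ u, gw (k + 1) u)) := by
  have h := (part1_tendsto a ha k).add (main_tendsto a k)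
  rw [zero_add] at h
  refine h.congr' ?_
  filter_upwards [eventually_ge_atTop 8] with χ hχ
  have h0 : 0 < χ := by linarith
  have hp : χ ^ a ≠ 0 := (Real.rpow_pos_of_pos h0 a).ne'
  obtain ⟨i2, e2⟩ := part2 a k χ (by linarith)
  rw [← Set.Ioc_union_Ioi_eq_Ioi (show (0 : ℝ) ≤ χ / 2 by linarith),
    setIntegral_union (Set.Ioc_disjoint_Ioi le_rfl) measurableSet_Ioi (part1 a ha k χ hχ).1 i2, e2]
  field_simp
  ring

lemma S_eq (b : ℝ) (k : ℕ) (χ : ℝ) :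
    S b k χ = (1 / Real.Gamma b) * ∫ τ in Set.Ioi 0, τ ^ (b - 1) * gw k (τ - χ) := by
  unfold S gw
  simp only [mul_assoc]

/-- Large-`χ` behaviour of `S_k(χ)`: for even `k`,
`S_k(χ) ~ 2^{(k+1)/2} Γ((k+1)/2) χ^{b-1} / Γ(b)`; for odd `k` (and `b ≠ 1`),
`S_k(χ) ~ 2^{k/2+1} Γ(k/2+1) χ^{b-2} / Γ(b-1)`. -/
theorem S_large_chi (b : ℝ) (hb : 0 < b) (k : ℕ) :
    (Even k →
      Tendsto (fun χ : ℝ => S b k χ / χ ^ (b - 1)) atTop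
        (𝓝 (2 ^ (((k : ℝ) + 1) / 2) * Real.Gamma (((k : ℝ) + 1) / 2) / Real.Gamma b))) ∧
    (Odd k → b ≠ 1 →
      Tendsto (fun χ : ℝ => S b k χ / χ ^ (b - 2)) atTop
        (𝓝 (2 ^ ((k : ℝ) / 2 + 1) * Real.Gamma ((k : ℝ) / 2 + 1) / Real.Gamma (b - 1)))) := by
  have ha : -1 < b - 1 := by linarith
  have hT := total_tendsto (b - 1) ha k
  constructor
  · intro hk
    have h1 := hT.mul tendsto_inv_atTop_zero
    rw [mul_zero] at h1
    have h2 := (h1.add_const (∫ u, gw k u)).const_mul (1 / Real.Gamma b)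
    rw [zero_add, gw_even k hk] at h2
    have e : 2 ^ (((k : ℝ) + 1) / 2) * Real.Gamma (((k : ℝ) + 1) / 2) / Real.Gamma b =
      1 / Real.Gamma b * (2 ^ (((k : ℝ) + 1) / 2) * Real.Gamma (((k : ℝ) + 1) / 2)) := by ring
    rw [e]
    refine h2.congr' ?_
    filter_upwards [eventually_gt_atTop 0] with χ h0
    rw [S_eq]
    field_simp
    try ring
  · intro hk hb1
    have h2 := hT.const_mul (1 / Real.Gamma b)
    have hk1 : Even (k + 1) := hk.add_one
    rw [gw_odd k hk, gw_even (k + 1) hk1] at h2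
    have hb1' : b - 1 ≠ 0 := sub_ne_zero.2 hb1
    have hG : Real.Gamma b = (b - 1) * Real.Gamma (b - 1) := by
      have := Real.Gamma_add_one hb1'
      rwa [sub_add_cancel] at this
    have e : 2 ^ ((k : ℝ) / 2 + 1) * Real.Gamma ((k : ℝ) / 2 + 1) / Real.Gamma (b - 1) =
        1 / Real.Gamma b * ((b - 1) * (2 ^ ((((k + 1 : ℕ) : ℝ) + 1) / 2) *
          Real.Gamma ((((k + 1 : ℕ) : ℝ) + 1) / 2))) := by
      have e1 : (((k + 1 : ℕ) : ℝ) + 1) / 2 = (k : ℝ) / 2 + 1 := by push_cast; ring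
      have hG0 : Real.Gamma (b - 1) ≠ 0 := by
        intro h
        rw [h, mul_zero] at hG
        exact (Real.Gamma_pos_of_pos hb).ne' hG
      rw [e1, hG]
      field_simp
    rw [e]
    refine h2.congr' ?_
    filter_upwards [eventually_gt_atTop 0] with χ h0
    have e3 : χ ^ (b - 1) = χ ^ (b - 2) * χ := by
      rw [← Real.rpow_add_one h0.ne']; congr 1; ring
    have hp : χ ^ (b - 2) ≠ 0 := (Real.rpow_pos_of_pos h0 _).ne'
    rw [S_eq, e3]
    field_simp
    try ring
end

section
/- Let b, c be real numbers. Then as λ→+∞, Γ(c+λ)/Γ(c+λ−b) = λ^b·(1 + b(2c−b−1)/(2λ) + b(b−1)·(3(2c−b−1)²−b−1)/(24λ²) + O(λ^{−3})). Equivalently, λ²·(λ^{−b}·Γ(c+λ)/Γ(c+λ−b) − 1 − b(2c−b−1)/(2λ)) tends to b(b−1)(3(2c−b−1)²−b−1)/24 as λ→+∞. -/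
open Real Filter Topology

lemma gre_log (a : ℝ) : Tendsto (fun l : ℝ => l ^ 3 * (log (1 + a / l)
    - (a / l - a ^ 2 / (2 * l ^ 2) + a ^ 3 / (3 * l ^ 3)))) atTop (𝓝 0) := by
  have h0 : Tendsto (fun l : ℝ => 2 * a ^ 4 / l) atTop (𝓝 0) :=
    tendsto_const_nhds.div_atTop tendsto_id
  refine squeeze_zero_norm' ?_ h0
  filter_upwards [eventually_gt_atTop (2 * |a|), eventually_gt_atTop 0] with l hl hl0
  have hx : |-(a / l)| ≤ 1 / 2 := by
    rw [abs_neg, abs_div, abs_of_pos hl0, div_le_iff₀ hl0]; linarith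
  have h := abs_log_sub_add_sum_range_le (x := -(a / l)) (by linarith) 3
  have e : (∑ i ∈ Finset.range 3, (-(a / l)) ^ (i + 1) / ((i : ℝ) + 1)) + log (1 - -(a / l))
      = log (1 + a / l) - (a / l - a ^ 2 / (2 * l ^ 2) + a ^ 3 / (3 * l ^ 3)) := by
    simp only [Finset.sum_range_succ, Finset.sum_range_zero, sub_neg_eq_add]
    push_cast
    field_simp
    ring
  rw [e] at h
  rw [norm_mul, Real.norm_eq_abs, Real.norm_eq_abs, abs_of_pos (by positivity : (0:ℝ) < l ^ 3)]
  have h2 : |-(a / l)| ^ (3 + 1) / (1 - |-(a / l)|) ≤ 2 * (a / l) ^ 4 := by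
    rw [div_le_iff₀ (by linarith)]
    have : |-(a / l)| ^ (3 + 1) = (a / l) ^ 4 := by
      rw [abs_neg]; exact (by decide : Even 4).pow_abs _
    rw [this]
    have : 0 ≤ (a / l) ^ 4 := by positivity
    nlinarith
  calc _ ≤ l ^ 3 * (2 * (a / l) ^ 4) := by gcongr; exact h.trans h2
    _ = _ := by field_simp

lemma gre_tele (g : ℝ → ℝ)
    (h0 : ∀ᶠ l in atTop, Tendsto (fun n : ℕ => g (l + n)) atTop (𝓝 0))
    (h1 : Tendsto (fun l : ℝ => l ^ 3 * (g (l + 1) - g l)) atTop (𝓝 0)) :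
    Tendsto (fun l : ℝ => l ^ 2 * g l) atTop (𝓝 0) := by
  rw [Metric.tendsto_nhds]
  intro ε hε
  have h2 := (Metric.tendsto_nhds.1 h1 (ε / 4) (by positivity))
  obtain ⟨L, hL⟩ := eventually_atTop.1 h2
  filter_upwards [h0, eventually_ge_atTop L, eventually_ge_atTop 1] with l hl hlL hl1
  have step : ∀ x, L ≤ x → 1 ≤ x → |g (x + 1) - g x| ≤ ε / 2 * (1 / x ^ 2 - 1 / (x + 1) ^ 2) := by
    intro x hx hx1
    have h3 := hL x hx
    rw [Real.dist_eq, sub_zero, abs_mul, abs_of_pos (by positivity : 0 < x ^ 3)] at h3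
    have h4 : |g (x + 1) - g x| ≤ ε / 4 * (1 / x ^ 3) := by
      rw [mul_one_div, le_div_iff₀ (by positivity)]; linarith
    have h5 : 1 / x ^ 3 ≤ 2 * (1 / x ^ 2 - 1 / (x + 1) ^ 2) := by
      have : 2 * (1 / x ^ 2 - 1 / (x + 1) ^ 2) - 1 / x ^ 3
          = (3 * x ^ 2 - 1) / (x ^ 3 * (x + 1) ^ 2) := by
        field_simp; ring
      have h6 : 0 ≤ (3 * x ^ 2 - 1) / (x ^ 3 * (x + 1) ^ 2) := by
        apply div_nonneg _ (by positivity); nlinarith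
      linarith
    nlinarith
  have hn : ∀ n : ℕ, |g (l + n) - g l| ≤ ε / 2 * (1 / l ^ 2 - 1 / (l + n) ^ 2) := by
    intro n
    induction n with
    | zero => simp
    | succ n ih =>
      have hnn : (0 : ℝ) ≤ n := n.cast_nonneg
      have := step (l + n) (by linarith) (by linarith)
      have h7 := abs_add_le (g (l + n + 1) - g (l + n)) (g (l + n) - g l)
      push_cast
      rw [← add_assoc]
      rw [sub_add_sub_cancel] at h7
      linarith
  have hlim : |0 - g l| ≤ ε / 2 * (1 / l ^ 2) := by
    refine le_of_tendsto ((hl.sub_const (g l)).abs) (Eventually.of_forall fun n => ?_)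
    refine (hn n).trans ?_
    gcongr
    have : 0 ≤ 1 / (l + n) ^ 2 := by positivity
    linarith
  rw [Real.dist_eq, sub_zero, abs_mul, abs_of_pos (by positivity : 0 < l ^ 2)]
  rw [zero_sub, abs_neg, mul_one_div, le_div_iff₀ (by positivity)] at hlim
  linarith

lemma gre_feq {y : ℝ} (hy : 0 < y) :
    log (Gamma (y + 1)) = log (Gamma y) + log y := by
  rw [Gamma_add_one hy.ne', log_mul hy.ne' (Gamma_pos_of_pos hy).ne', add_comm]

lemma gre_lim1 {x : ℝ} (hx : 0 < x) :
    Tendsto (fun n : ℕ => log (Gamma (x + (n + 1 : ℕ))) - x * log n - log (n.factorial)) atTop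
      (𝓝 0) := by
  have h := (BohrMollerup.tendsto_log_gamma hx).const_sub (log (Gamma x))
  rw [sub_self] at h
  refine h.congr fun n => ?_
  have := BohrMollerup.f_add_nat_eq (f := fun y => log (Gamma y)) (fun {y} hy => gre_feq hy) hx
    (n + 1)
  rw [this, BohrMollerup.logGammaSeq]
  ring

lemma gre_lim2 (l : ℝ) (_hl : 0 < l) :
    Tendsto (fun n : ℕ => log (l + (n + 1 : ℕ)) - log n) atTop (𝓝 0) := by
  have h : Tendsto (fun n : ℕ => log (1 + (l + 1) / (n : ℝ))) atTop (𝓝 (log (1 + 0))) := by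
    refine Tendsto.log ?_ (by norm_num)
    exact (tendsto_const_nhds.div_atTop tendsto_natCast_atTop_atTop).const_add 1
  rw [add_zero, log_one] at h
  refine h.congr' ?_
  filter_upwards [eventually_gt_atTop 0] with n hn
  have hn' : (0 : ℝ) < n := by exact_mod_cast hn
  rw [← log_div (by positivity) (by positivity)]
  congr 1
  push_cast
  field_simp
  ring

noncomputable def greG (b c A B : ℝ) (l : ℝ) : ℝ :=
  log (Gamma (c + l)) - log (Gamma (c + l - b)) - b * log l - A / l - B / l ^ 2

lemma gre_lim (b c A B l : ℝ) (hl : 0 < l) (h1 : 0 < c + l) (h2 : 0 < c + l - b) :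
    Tendsto (fun n : ℕ => greG b c A B (l + n)) atTop (𝓝 0) := by
  rw [← tendsto_add_atTop_iff_nat 1]
  have hT : Tendsto (fun n : ℕ => l + ((n + 1 : ℕ) : ℝ)) atTop atTop :=
    tendsto_atTop_add_const_left _ _
      (tendsto_natCast_atTop_atTop.comp (tendsto_add_atTop_nat 1))
  have hA : Tendsto (fun n : ℕ => A / (l + ((n + 1 : ℕ) : ℝ))) atTop (𝓝 0) :=
    tendsto_const_nhds.div_atTop hT
  have hB : Tendsto (fun n : ℕ => B / (l + ((n + 1 : ℕ) : ℝ)) ^ 2) atTop (𝓝 0) :=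
    tendsto_const_nhds.div_atTop ((tendsto_pow_atTop two_ne_zero).comp hT)
  have h := ((((gre_lim1 h1).sub (gre_lim1 h2)).sub ((gre_lim2 l hl).const_mul b)).sub hA).sub hB
  simp only [sub_zero, mul_zero] at h
  refine h.congr fun n => ?_
  have e1 : c + (l + ((n + 1 : ℕ) : ℝ)) = c + l + ((n + 1 : ℕ) : ℝ) := by ring
  have e2 : c + l + ((n + 1 : ℕ) : ℝ) - b = c + l - b + ((n + 1 : ℕ) : ℝ) := by ring
  rw [greG, e1, e2]
  ring

lemma gre_inc (b c A B : ℝ) (hA : A = b * (2 * c - b - 1) / 2)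
    (hB : B = (A - (c ^ 3 - (c - b) ^ 3 - b) / 3) / 2) :
    Tendsto (fun l : ℝ => l ^ 3 * (greG b c A B (l + 1) - greG b c A B l)) atTop (𝓝 0) := by
  have hT : Tendsto (fun l : ℝ => l + 1) atTop atTop := tendsto_atTop_add_const_right _ _ tendsto_id
  have r1 : Tendsto (fun l : ℝ => (A - 3 * B) / (l + 1)) atTop (𝓝 0) :=
    tendsto_const_nhds.div_atTop hT
  have r2 : Tendsto (fun l : ℝ => B / (l + 1) ^ 2) atTop (𝓝 0) :=
    tendsto_const_nhds.div_atTop ((tendsto_pow_atTop two_ne_zero).comp hT)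
  have h := ((((gre_log c).sub (gre_log (c - b))).sub ((gre_log 1).const_mul b)).add r1).add r2
  simp only [sub_zero, mul_zero, add_zero] at h
  refine h.congr' ?_
  filter_upwards [eventually_gt_atTop 0, eventually_gt_atTop (-c), eventually_gt_atTop (b - c)]
    with l h0 h1 h2
  have p1 : 0 < c + l := by linarith
  have p2 : 0 < c + l - b := by linarith
  have p3 : 0 < l + 1 := by linarith
  have e1 : log (1 + c / l) = log (c + l) - log l := by
    rw [← log_div p1.ne' h0.ne']; congr 1; field_simp; ring
  have e2 : log (1 + (c - b) / l) = log (c + l - b) - log l := by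
    rw [← log_div p2.ne' h0.ne']; congr 1; field_simp; ring
  have e3 : log (1 + 1 / l) = log (l + 1) - log l := by
    rw [← log_div p3.ne' h0.ne']; congr 1; field_simp
  rw [greG, greG, e1, e2, e3]
  have e4 : c + (l + 1) = c + l + 1 := by ring
  have e5 : c + l + 1 - b = c + l - b + 1 := by ring
  rw [e4, e5, gre_feq p1, gre_feq p2]
  generalize log (c + l) = x1
  generalize log (c + l - b) = x2
  generalize log (l + 1) = x3
  generalize log l = x4
  generalize log (Gamma (c + l)) = x5
  generalize log (Gamma (c + l - b)) = x6
  subst hB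
  subst hA
  field_simp
  ring

/-- Asymptotic expansion of the Gamma-function ratio
`Γ(c+λ)/Γ(c+λ-b) = λ^b (1 + b(2c-b-1)/(2λ) + b(b-1)(3(2c-b-1)²-b-1)/(24λ²) + O(λ⁻³))`,
in the equivalent limit form:
`λ² (λ^{-b} Γ(c+λ)/Γ(c+λ-b) - 1 - b(2c-b-1)/(2λ)) → b(b-1)(3(2c-b-1)²-b-1)/24` as `λ → ∞`. -/
theorem gamma_ratio_expansion (b c : ℝ) :
    Tendsto
      (fun lam : ℝ =>
        lam ^ 2 * (lam ^ (-b) * (Real.Gamma (c + lam) / Real.Gamma (c + lam - b)) - 1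
          - b * (2 * c - b - 1) / (2 * lam)))
      atTop
      (𝓝 (b * (b - 1) * (3 * (2 * c - b - 1) ^ 2 - b - 1) / 24)) := by
  obtain ⟨A, hA⟩ : ∃ A, A = b * (2 * c - b - 1) / 2 := ⟨_, rfl⟩
  obtain ⟨B, hB⟩ : ∃ B, B = (A - (c ^ 3 - (c - b) ^ 3 - b) / 3) / 2 := ⟨_, rfl⟩
  have hg : Tendsto (fun l : ℝ => l ^ 2 * greG b c A B l) atTop (𝓝 0) := by
    refine gre_tele _ ?_ (gre_inc b c A B hA hB)
    filter_upwards [eventually_gt_atTop 0, eventually_gt_atTop (-c), eventually_gt_atTop (b - c)]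
      with l h0 h1 h2
    exact gre_lim b c A B l h0 (by linarith) (by linarith)
  set u : ℝ → ℝ := fun l => A / l + B / l ^ 2 + greG b c A B l with hu
  have i1 : Tendsto (fun l : ℝ => 1 / l) atTop (𝓝 0) := tendsto_const_nhds.div_atTop tendsto_id
  have hlu : Tendsto (fun l : ℝ => l * u l) atTop (𝓝 A) := by
    have h := ((i1.const_mul B).const_add A).add (hg.mul i1)
    simp only [mul_zero, add_zero] at h
    refine h.congr' ?_
    filter_upwards [eventually_gt_atTop 0] with l h0
    simp only [hu]
    field_simp
  have hu0 : Tendsto u atTop (𝓝 0) := by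
    have h := hlu.mul i1
    simp only [mul_zero] at h
    refine h.congr' ?_
    filter_upwards [eventually_gt_atTop 0] with l h0
    field_simp
  have hE : Tendsto (fun l : ℝ => l ^ 2 * (exp (u l) - 1 - u l - u l ^ 2 / 2)) atTop (𝓝 0) := by
    have h := (hlu.pow 2).mul hu0.abs
    simp only [abs_zero, mul_zero] at h
    refine squeeze_zero_norm' ?_ h
    have hs : ∀ᶠ l in atTop, |u l| < 1 := by
      have := hu0.abs
      rw [abs_zero] at this
      exact this.eventually_lt_const one_pos
    filter_upwards [hs] with l hl
    have h3 := Real.exp_bound hl.le (n := 3) (by norm_num)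
    have e : exp (u l) - ∑ m ∈ Finset.range 3, u l ^ m / (m.factorial : ℝ)
        = exp (u l) - 1 - u l - u l ^ 2 / 2 := by
      simp [Finset.sum_range_succ, Nat.factorial]; ring
    rw [e] at h3
    rw [norm_mul, Real.norm_eq_abs, Real.norm_eq_abs, abs_of_nonneg (sq_nonneg l)]
    have h4 : |u l| ^ 3 * (((3 : ℕ).succ : ℝ) / (((3 : ℕ).factorial : ℝ) * ((3 : ℕ) : ℝ)))
        ≤ u l ^ 2 * |u l| := by
      have : |u l| ^ 3 = u l ^ 2 * |u l| := by rw [pow_succ, sq_abs]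
      rw [this]
      have : 0 ≤ u l ^ 2 * |u l| := by positivity
      norm_num [Nat.factorial]
      linarith
    calc _ ≤ l ^ 2 * (u l ^ 2 * |u l|) := by gcongr; exact h3.trans h4
      _ = _ := by ring
  have h := ((hE.add hg).add_const B).add ((hlu.pow 2).div_const 2)
  have ev : 0 + 0 + B + A ^ 2 / 2 = b * (b - 1) * (3 * (2 * c - b - 1) ^ 2 - b - 1) / 24 := by
    rw [hB, hA]; ring
  rw [ev] at h
  refine h.congr' ?_
  filter_upwards [eventually_gt_atTop 0, eventually_gt_atTop (-c), eventually_gt_atTop (b - c)]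
    with l h0 h1 h2
  have p1 := Gamma_pos_of_pos (show 0 < c + l by linarith)
  have p2 := Gamma_pos_of_pos (show 0 < c + l - b by linarith)
  have hexp : exp (u l) = l ^ (-b) * (Gamma (c + l) / Gamma (c + l - b)) := by
    have : u l = log l * (-b) + (log (Gamma (c + l)) - log (Gamma (c + l - b))) := by
      simp only [hu, greG]; ring
    rw [this, exp_add, exp_sub, exp_log p1, exp_log p2, ← rpow_def_of_pos h0]
  rw [← hexp]
  have hA2 : b * (2 * c - b - 1) / (2 * l) = A / l := by rw [hA]; field_simp
  rw [hA2]
  have hgu : greG b c A B l = u l - A / l - B / l ^ 2 := by simp only [hu]; ring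
  rw [hgu]
  generalize u l = v
  field_simp
  ring
end
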